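/- Let W be an irreducible Coxeter group that is neither finite nor affine (generic). Then every normal subgroup of W that contains no free subgroup of rank 2 is trivial. -/

import Mathlib

/-- The Coxeter graph of a Coxeter matrix: vertices are the indices, and two distinct
indices `i`, `j` are adjacent iff `M i j ≠ 2`. -/
def coxeterGraph {B : Type*} (M : CoxeterMatrix B) : SimpleGraph B :=
  SimpleGraph.fromRel (fun i j => M i j ≠ 2)

/-- The matrix of the canonical bilinear form of a Coxeter group:
`⟨αᵢ | αⱼ⟩ = -cos (π / mᵢⱼ)`, interpreted as `-1` when `mᵢⱼ = ∞` (encoded by `0`). -/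
noncomputable def coxeterBilinMatrix {B : Type*} [Fintype B] (M : CoxeterMatrix B) :
    Matrix B B ℝ :=
  fun i j => if M i j = 0 then -1 else -Real.cos (Real.pi / (M i j : ℝ))

/-- An irreducible Coxeter group is of affine type if its canonical bilinear form is
positive semidefinite but not positive definite. -/
noncomputable def CoxeterMatrix.IsAffineType {B : Type*} [Fintype B] (M : CoxeterMatrix B) :
    Prop :=
  (coxeterBilinMatrix M).PosSemidef ∧ ¬ (coxeterBilinMatrix M).PosDef

/-- A group is *narrow* if it contains no copy of the free group of rank 2. -/
def IsNarrow (G : Type*) [Group G] : Prop :=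
  ∀ f : FreeGroup (Fin 2) →* G, ¬ Function.Injective f

section Boost

open scoped Pointwise Function in
/-- A ping-pong criterion in which each generator only has to control its nonzero powers
on the other ping-pong sets. -/
theorem FreeGroup.injective_lift_of_zpow_ping_pong {ι G α : Type*} [Nontrivial ι] [Group G]
    [MulAction G α] (a : ι → G) (X : ι → Set α) (hne : ∀ i, (X i).Nonempty)
    (hdisj : Pairwise (Disjoint on X))
    (hpp : ∀ i j, i ≠ j → ∀ n : ℤ, n ≠ 0 → ∀ v ∈ X j, a i ^ n • v ∈ X i) :
    Function.Injective (FreeGroup.lift a) := by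
  have hlift : FreeGroup.lift a =
      (Monoid.CoprodI.lift fun i => FreeGroup.lift fun _ : Unit => a i).comp
        (@freeGroupEquivCoprodI ι).toMonoidHom := by
    ext i
    simp
  rw [hlift, MonoidHom.coe_comp]
  refine Function.Injective.comp ?_ (MulEquiv.injective freeGroupEquivCoprodI)
  refine Monoid.CoprodI.lift_injective_of_ping_pong
    (fun i => FreeGroup.lift fun _ : Unit => a i) ?_ X hne hdisj ?_
  · inhabit ι
    refine Or.inr ⟨default, ?_⟩
    rw [FreeGroup.freeGroupUnitEquivInt.cardinal_eq, Cardinal.mk_denumerable]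
    exact Cardinal.natCast_le_aleph0
  · intro i j hij
    refine FreeGroup.freeGroupUnitEquivInt.forall_congr_left.mpr ?_
    intro n hn
    have hn0 : n ≠ 0 := by
      rintro rfl
      apply hn
      simp [FreeGroup.freeGroupUnitEquivInt]
    change FreeGroup.lift (fun _ => a i) (FreeGroup.of () ^ n) • X j ⊆ X i
    simp only [map_zpow, FreeGroup.lift_apply_of]
    rintro _ ⟨v, hv, rfl⟩
    exact hpp i j hij n hn0 v hv

variable {V : Type*} [AddCommGroup V] [Module ℝ V]

/-- `g` is a boost for the form `b`: it scales the isotropic vectors `x` and `y` by `lam > 1` and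
`lam⁻¹` and fixes the orthogonal complement of their span. -/
structure IsBoost (b : V →ₗ[ℝ] V →ₗ[ℝ] ℝ) (g : V ≃ₗ[ℝ] V) (x y : V) (lam : ℝ) : Prop where
  one_lt : 1 < lam
  left_isotropic : b x x = 0
  right_isotropic : b y y = 0
  pair_ne_zero : b x y ≠ 0
  apply_eq : ∀ v, g v =
    v + ((lam - 1) * (b v y / b x y)) • x + ((lam⁻¹ - 1) * (b v x / b x y)) • y

namespace IsBoost

variable {b : V →ₗ[ℝ] V →ₗ[ℝ] ℝ} {g : V ≃ₗ[ℝ] V} {x y : V} {lam : ℝ}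

theorem apply_left (hg : IsBoost b g x y lam) : g x = lam • x := by
  rw [hg.apply_eq, div_self hg.pair_ne_zero, hg.left_isotropic]
  module

theorem apply_right (hb : ∀ v w, b v w = b w v) (hg : IsBoost b g x y lam) :
    g y = lam⁻¹ • y := by
  rw [hg.apply_eq, hb y x, div_self hg.pair_ne_zero, hg.right_isotropic]
  module

theorem pow_apply (hb : ∀ v w, b v w = b w v) (hg : IsBoost b g x y lam) (n : ℕ) (v : V) :
    (g ^ n) v = v + ((lam ^ n - 1) * (b v y / b x y)) • x
      + (((lam ^ n)⁻¹ - 1) * (b v x / b x y)) • y := by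
  induction n with
  | zero => simp
  | succ n ih =>
    rw [pow_succ', LinearEquiv.mul_apply, ih, map_add, map_add, map_smul, map_smul,
      hg.apply_left, hg.apply_right hb, hg.apply_eq, pow_succ, mul_inv]
    module

theorem inv (hb : ∀ v w, b v w = b w v) (hg : IsBoost b g x y lam) :
    IsBoost b g⁻¹ y x lam where
  one_lt := hg.one_lt
  left_isotropic := hg.right_isotropic
  right_isotropic := hg.left_isotropic
  pair_ne_zero := by rw [hb]; exact hg.pair_ne_zero
  apply_eq v := by
    have hlam : lam ≠ 0 := by linarith [hg.one_lt] |> fun h : 0 < lam => h.ne'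
    apply g.injective
    rw [← LinearEquiv.mul_apply, mul_inv_cancel, LinearEquiv.coe_one, id, map_add, map_add,
      map_smul, map_smul, hg.apply_left, hg.apply_right hb, hg.apply_eq, hb y x]
    match_scalars <;> field_simp <;> ring

theorem conj (hg : IsBoost b g x y lam) (w : V ≃ₗ[ℝ] V) (hw : ∀ u v, b (w u) (w v) = b u v) :
    IsBoost b (w * g * w⁻¹) (w x) (w y) lam where
  one_lt := hg.one_lt
  left_isotropic := by rw [hw, hg.left_isotropic]
  right_isotropic := by rw [hw, hg.right_isotropic]
  pair_ne_zero := by rw [hw]; exact hg.pair_ne_zero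
  apply_eq v := by
    obtain ⟨v, rfl⟩ := w.surjective v
    have : w⁻¹ (w v) = v := w.symm_apply_apply v
    simp only [LinearEquiv.mul_apply, this, hw, hg.apply_eq, map_add, map_smul]

end IsBoost

/-- The vectors whose pairings with the family `T` agree with those of a nonzero multiple of `z`
up to a relative error `ε`. -/
def nearLine {ι : Type*} (b : V →ₗ[ℝ] V →ₗ[ℝ] ℝ) (T : ι → V) (ε : ℝ) (z : V) : Set V :=
  {v | ∃ t : ℝ, t ≠ 0 ∧ ∀ j, |b v (T j) - t * b z (T j)| ≤ ε * |t|}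

theorem self_mem_nearLine {ι : Type*} (b : V →ₗ[ℝ] V →ₗ[ℝ] ℝ) (T : ι → V) {ε : ℝ} (hε : 0 ≤ ε)
    (z : V) : z ∈ nearLine b T ε z :=
  ⟨1, one_ne_zero, fun j => by simpa using hε⟩

theorem disjoint_nearLine {ι : Type*} (b : V →ₗ[ℝ] V →ₗ[ℝ] ℝ) (T : ι → V) {ε : ℝ} (hε : 0 < ε)
    {i j : ι} (hi : b (T i) (T i) = 0) (hj : b (T j) (T j) = 0)
    (hij : 4 * ε ≤ |b (T i) (T j)|) (hji : 4 * ε ≤ |b (T j) (T i)|) :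
    Disjoint (nearLine b T ε (T i)) (nearLine b T ε (T j)) := by
  rw [Set.disjoint_left]
  rintro v ⟨t, ht, h⟩ ⟨t', ht', h'⟩
  have h1 := h i
  have h2 := h j
  have h3 := h' i
  have h4 := h' j
  rw [hi, mul_zero, sub_zero] at h1
  rw [hj, mul_zero, sub_zero] at h4
  have h5 : |t * b (T i) (T j)| - |b v (T j)| ≤ |b v (T j) - t * b (T i) (T j)| := by
    rw [abs_sub_comm]; exact abs_sub_abs_le_abs_sub _ _
  have h6 : |t' * b (T j) (T i)| - |b v (T i)| ≤ |b v (T i) - t' * b (T j) (T i)| := by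
    rw [abs_sub_comm]; exact abs_sub_abs_le_abs_sub _ _
  rw [abs_mul] at h5 h6
  have ht0 := abs_pos.mpr ht
  have ht0' := abs_pos.mpr ht'
  have h7 : |t| * (4 * ε) ≤ |t| * |b (T i) (T j)| := by gcongr
  have h8 : |t'| * (4 * ε) ≤ |t'| * |b (T j) (T i)| := by gcongr
  have h9 : 0 < ε * |t| := by positivity
  have h10 : 0 < ε * |t'| := by positivity
  nlinarith

/-- Large powers of a boost attract everything near a line transverse to its axis. -/
theorem IsBoost.exists_pow_mem_nearLine {ι : Type*} [Finite ι] {b : V →ₗ[ℝ] V →ₗ[ℝ] ℝ}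
    (hb : ∀ v w, b v w = b w v) {g : V ≃ₗ[ℝ] V} {lam : ℝ} (T : ι → V) {i j : ι}
    (hg : IsBoost b g (T i) (T j) lam) {ε : ℝ} (hε : 0 < ε) {z : V}
    (hz : 4 * ε ≤ |b z (T j)|) :
    ∃ N : ℕ, ∀ n ≥ N, ∀ v ∈ nearLine b T ε z, (g ^ n) v ∈ nearLine b T ε (T i) := by
  obtain ⟨K, hK⟩ : ∃ K : ℝ, ∀ k, |b z (T k)| ≤ K ∧ |b (T i) (T k)| ≤ K ∧ |b (T j) (T k)| ≤ K := by
    obtain ⟨K₁, h₁⟩ := (Set.finite_range fun k => |b z (T k)|).bddAbove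
    obtain ⟨K₂, h₂⟩ := (Set.finite_range fun k => |b (T i) (T k)|).bddAbove
    obtain ⟨K₃, h₃⟩ := (Set.finite_range fun k => |b (T j) (T k)|).bddAbove
    refine ⟨max K₁ (max K₂ K₃), fun k => ⟨?_, ?_, ?_⟩⟩
    · exact le_max_of_le_left (h₁ ⟨k, rfl⟩)
    · exact le_max_of_le_right (le_max_of_le_left (h₂ ⟨k, rfl⟩))
    · exact le_max_of_le_right (le_max_of_le_right (h₃ ⟨k, rfl⟩))
  set c := b (T i) (T j) with hc
  have hc0 : 0 < |c| := abs_pos.mpr hg.pair_ne_zero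
  have hK0 : 0 ≤ K := (abs_nonneg _).trans (hK i).1
  set D := (K + ε) + (K + ε) / |c| * K + (K + ε) / |c| * K with hD
  have hD0 : 0 ≤ D := by positivity
  obtain ⟨N, hN⟩ := pow_unbounded_of_one_lt (D * |c| / (3 * ε * ε)) hg.one_lt
  refine ⟨N, fun n hn v ⟨t, ht, hv⟩ => ?_⟩
  have ht0 := abs_pos.mpr ht
  have hpow1 : 1 ≤ lam ^ n := one_le_pow₀ hg.one_lt.le
  have hpow : D * |c| ≤ lam ^ n * (3 * ε * ε) := by
    rw [← div_le_iff₀ (by positivity)]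
    exact hN.le.trans (pow_le_pow_right₀ hg.one_lt.le hn)
  have hbound : ∀ k, |b v (T k)| ≤ (K + ε) * |t| := fun k => by
    have h1 := abs_sub_abs_le_abs_sub (b v (T k)) (t * b z (T k))
    have h2 := hv k
    have h3 : |t| * |b z (T k)| ≤ |t| * K := by gcongr; exact (hK k).1
    rw [abs_mul] at h1
    linarith
  have hlow : 3 * ε * |t| ≤ |b v (T j)| := by
    have h1 := abs_sub_abs_le_abs_sub (t * b z (T j)) (b v (T j))
    rw [abs_sub_comm, abs_mul] at h1
    have h2 := hv j
    have h3 : |t| * (4 * ε) ≤ |t| * |b z (T j)| := by gcongr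
    linarith
  refine ⟨lam ^ n * (b v (T j) / c), ?_, fun k => ?_⟩
  · have : b v (T j) ≠ 0 := abs_pos.mp (lt_of_lt_of_le (by positivity) hlow)
    have := hg.pair_ne_zero
    positivity
  · have hexp : b ((g ^ n) v) (T k) - lam ^ n * (b v (T j) / c) * b (T i) (T k)
        = b v (T k) - b v (T j) / c * b (T i) (T k)
          + ((lam ^ n)⁻¹ - 1) * (b v (T i) / c * b (T j) (T k)) := by
      rw [hg.pow_apply hb]
      simp only [map_add, map_smul, LinearMap.add_apply, LinearMap.smul_apply, smul_eq_mul]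
      ring
    have hinv : |(lam ^ n)⁻¹ - 1| ≤ 1 := by
      have h1 : (lam ^ n)⁻¹ ≤ 1 := inv_le_one_of_one_le₀ hpow1
      have h2 : 0 < (lam ^ n)⁻¹ := by positivity
      rw [abs_le]; constructor <;> linarith
    have hdiv : ∀ k l, ∀ s, |b s (T l)| ≤ K →
        |b v (T k) / c * b s (T l)| ≤ (K + ε) / |c| * K * |t| := fun k l s hs => by
      rw [abs_mul, abs_div]
      calc |b v (T k)| / |c| * |b s (T l)| ≤ ((K + ε) * |t|) / |c| * K := by
            gcongr; exact hbound k
        _ = _ := by ring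
    calc |b ((g ^ n) v) (T k) - lam ^ n * (b v (T j) / c) * b (T i) (T k)|
        ≤ |b v (T k)| + |b v (T j) / c * b (T i) (T k)|
          + |((lam ^ n)⁻¹ - 1) * (b v (T i) / c * b (T j) (T k))| := by
          rw [hexp]
          exact (abs_add_le _ _).trans (by gcongr; exact abs_sub _ _)
      _ ≤ (K + ε) * |t| + (K + ε) / |c| * K * |t| + 1 * ((K + ε) / |c| * K * |t|) := by
          rw [abs_mul ((lam ^ n)⁻¹ - 1)]
          exact add_le_add (add_le_add (hbound k) (hdiv _ _ _ (hK k).2.1))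
            (mul_le_mul hinv (hdiv _ _ _ (hK k).2.2) (abs_nonneg _) zero_le_one)
      _ = D * |t| := by rw [hD]; ring
      _ ≤ ε * (lam ^ n * (|b v (T j)| / |c|)) := by
          have h1 : ε * (lam ^ n * (3 * ε * |t| / |c|)) ≤ ε * (lam ^ n * (|b v (T j)| / |c|)) := by
            gcongr
          refine le_trans ?_ h1
          have h2 : ε * (lam ^ n * (3 * ε * |t| / |c|)) = (lam ^ n * (3 * ε * ε)) / |c| * |t| := by
            ring
          rw [h2]
          gcongr
          rwa [le_div_iff₀ hc0]
      _ = ε * |lam ^ n * (b v (T j) / c)| := by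
          rw [abs_mul, abs_div, abs_of_nonneg (by positivity : 0 ≤ lam ^ n)]

/-- Sufficiently high powers of two boosts whose axes are in general position generate a free
group. -/
theorem IsBoost.exists_injective_lift {b : V →ₗ[ℝ] V →ₗ[ℝ] ℝ} (hb : ∀ v w, b v w = b w v)
    {g g' : V ≃ₗ[ℝ] V} {x y x' y' : V} {lam lam' : ℝ} (hg : IsBoost b g x y lam)
    (hg' : IsBoost b g' x' y' lam') (hxx : b x x' ≠ 0) (hxy : b x y' ≠ 0) (hyx : b y x' ≠ 0)
    (hyy : b y y' ≠ 0) :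
    ∃ N : ℕ, Function.Injective (FreeGroup.lift ![g ^ N, g' ^ N]) := by
  set T : Fin 4 → V := ![x, y, x', y'] with hT
  have hiso : ∀ i, b (T i) (T i) = 0 := by
    intro i
    fin_cases i
    exacts [hg.left_isotropic, hg.right_isotropic, hg'.left_isotropic, hg'.right_isotropic]
  have hne : ∀ i j, i ≠ j → b (T i) (T j) ≠ 0 := by
    have hlt : ∀ i j, i < j → b (T i) (T j) ≠ 0 := by
      intro i j hij
      fin_cases i <;> fin_cases j <;>
        first | exact absurd hij (by decide) | assumption | exact hg.pair_ne_zero |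
          exact hg'.pair_ne_zero
    intro i j hij
    rcases lt_or_gt_of_ne hij with h | h
    · exact hlt i j h
    · rw [hb]; exact hlt j i h
  obtain ⟨ε, hε, hsep⟩ : ∃ ε > 0, ∀ i j, i ≠ j → 4 * ε ≤ |b (T i) (T j)| := by
    have : Nonempty {p : Fin 4 × Fin 4 // p.1 ≠ p.2} := ⟨⟨(0, 1), by decide⟩⟩
    obtain ⟨p, hp⟩ := Finite.exists_min fun p : {p : Fin 4 × Fin 4 // p.1 ≠ p.2} =>
      |b (T p.1.1) (T p.1.2)|
    refine ⟨|b (T p.1.1) (T p.1.2)| / 4, ?_, fun i j hij => ?_⟩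
    · have := abs_pos.mpr (hne _ _ p.2); positivity
    · linarith [hp ⟨(i, j), hij⟩]
  have hattract : ∀ {f : V ≃ₗ[ℝ] V} {l : ℝ} {i j k : Fin 4}, IsBoost b f (T i) (T j) l → k ≠ j →
      ∃ N : ℕ, ∀ n ≥ N, ∀ v ∈ nearLine b T ε (T k), (f ^ n) v ∈ nearLine b T ε (T i) :=
    fun hf hkj => hf.exists_pow_mem_nearLine hb T hε (hsep _ _ hkj)
  have hpp : ∀ {f : V ≃ₗ[ℝ] V} {l : ℝ} {i j k m : Fin 4}, IsBoost b f (T i) (T j) l →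
      k ≠ i → k ≠ j → m ≠ i → m ≠ j → ∃ N : ℕ, ∀ N' ≥ N, ∀ n : ℤ, n ≠ 0 →
        ∀ v ∈ nearLine b T ε (T k) ∪ nearLine b T ε (T m),
        ((f ^ N') ^ n) v ∈ nearLine b T ε (T i) ∪ nearLine b T ε (T j) := by
    intro f l i j k m hf hki hkj hmi hmj
    obtain ⟨N₁, h₁⟩ := hattract hf hkj
    obtain ⟨N₂, h₂⟩ := hattract hf hmj
    obtain ⟨N₃, h₃⟩ := hattract (hf.inv hb) hki
    obtain ⟨N₄, h₄⟩ := hattract (hf.inv hb) hmi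
    refine ⟨max (max N₁ N₂) (max N₃ N₄), fun N' hN' n hn v hv => ?_⟩
    simp only [ge_iff_le, max_le_iff] at hN'
    have hle : ∀ p : ℕ, p ≠ 0 → N' ≤ N' * p := fun p hp =>
      Nat.le_mul_of_pos_right _ (Nat.pos_of_ne_zero hp)
    obtain ⟨p, rfl | rfl⟩ := n.eq_nat_or_neg
    · have hp : p ≠ 0 := by rintro rfl; simp at hn
      rw [zpow_natCast, ← pow_mul]
      exact Or.inl (hv.elim (h₁ _ (hN'.1.1.trans (hle p hp)) v)
        (h₂ _ (hN'.1.2.trans (hle p hp)) v))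
    · have hp : p ≠ 0 := by rintro rfl; simp at hn
      rw [zpow_neg, zpow_natCast, ← pow_mul, ← inv_pow]
      exact Or.inr (hv.elim (h₃ _ (hN'.2.1.trans (hle p hp)) v)
        (h₄ _ (hN'.2.2.trans (hle p hp)) v))
  have hg₀ : IsBoost b g (T 0) (T 1) lam := hg
  have hg₁ : IsBoost b g' (T 2) (T 3) lam' := hg'
  obtain ⟨N₁, h₁⟩ := hpp (k := 2) (m := 3) hg₀ (by decide) (by decide) (by decide) (by decide)
  obtain ⟨N₂, h₂⟩ := hpp (k := 0) (m := 1) hg₁ (by decide) (by decide) (by decide) (by decide)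
  refine ⟨max N₁ N₂, FreeGroup.injective_lift_of_zpow_ping_pong (α := V) _
    ![nearLine b T ε (T 0) ∪ nearLine b T ε (T 1), nearLine b T ε (T 2) ∪ nearLine b T ε (T 3)]
    ?_ ?_ ?_⟩
  · intro i
    fin_cases i
    · exact ⟨T 0, Or.inl (self_mem_nearLine b T hε.le _)⟩
    · exact ⟨T 2, Or.inl (self_mem_nearLine b T hε.le _)⟩
  · have hd : ∀ i j, i ≠ j → Disjoint (nearLine b T ε (T i)) (nearLine b T ε (T j)) :=
      fun i j hij => disjoint_nearLine b T hε (hiso i) (hiso j) (hsep i j hij) (hsep j i hij.symm)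
    have h01 : Disjoint (nearLine b T ε (T 0) ∪ nearLine b T ε (T 1))
        (nearLine b T ε (T 2) ∪ nearLine b T ε (T 3)) := by
      simp only [Set.disjoint_union_left, Set.disjoint_union_right]
      exact ⟨⟨hd _ _ (by decide), hd _ _ (by decide)⟩, hd _ _ (by decide), hd _ _ (by decide)⟩
    intro i j hij
    fin_cases i <;> fin_cases j <;>
      first | exact absurd rfl hij | exact h01 | exact h01.symm
  · exact Fin.forall_fin_two.mpr
      ⟨Fin.forall_fin_two.mpr ⟨fun h => absurd rfl h, fun _ => h₁ _ (le_max_left _ _)⟩,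
        Fin.forall_fin_two.mpr ⟨fun _ => h₂ _ (le_max_right _ _), fun h => absurd rfl h⟩⟩

/-- The product of two reflections in unit vectors `a`, `c` with `|b a c| > 1` is a boost whose
isotropic eigenlines are exchanged by the reflections. -/
theorem exists_isBoost_mul {b : V →ₗ[ℝ] V →ₗ[ℝ] ℝ} (hb : ∀ v w, b v w = b w v) {a c : V}
    (ha : b a a = 1) (hc : b c c = 1) (hac : 1 < |b a c|) {sa sc : V ≃ₗ[ℝ] V}
    (hsa : ∀ v, sa v = v - (2 * b v a) • a) (hsc : ∀ v, sc v = v - (2 * b v c) • c) :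
    ∃ (x y : V) (lam t : ℝ), IsBoost b (sc * sa) x y lam ∧ t ≠ 0 ∧ sa y = t • x := by
  obtain ⟨t, ht, ht1⟩ : ∃ t : ℝ, t ^ 2 + 2 * b a c * t + 1 = 0 ∧ 1 < t ^ 2 := by
    have hd : 0 < b a c ^ 2 - 1 := by
      rw [← sq_abs]; nlinarith
    have hs := Real.sq_sqrt hd.le
    have hs0 := Real.sqrt_pos.mpr hd
    set r := √(b a c ^ 2 - 1)
    rcases lt_abs.mp hac with h | h
    · exact ⟨-b a c - r, by linear_combination hs, by nlinarith⟩
    · exact ⟨-b a c + r, by linear_combination hs, by nlinarith⟩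
  have ht0 : t ≠ 0 := by rintro rfl; norm_num at ht1
  have hsub : t ^ 2 - 1 ≠ 0 := by linarith [ht1] |> fun h : 0 < t ^ 2 - 1 => h.ne'
  have hk : b a c = -(1 + t ^ 2) / (2 * t) := by
    field_simp
    linear_combination ht
  have hca : b c a = -(1 + t ^ 2) / (2 * t) := by rw [hb, hk]
  have hxy : b (a + t • c) (t • a + c) = -(t ^ 2 - 1) ^ 2 / (2 * t) := by
    simp only [map_add, map_smul, LinearMap.add_apply, LinearMap.smul_apply, smul_eq_mul, ha, hc,
      hk, hca]
    field_simp
    ring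
  have hne : b (a + t • c) (t • a + c) ≠ 0 := by
    rw [hxy]
    exact div_ne_zero (neg_ne_zero.mpr (pow_ne_zero 2 hsub)) (mul_ne_zero two_ne_zero ht0)
  refine ⟨a + t • c, t • a + c, t ^ 2, t⁻¹, ⟨ht1, ?_, ?_, hne, fun v => ?_⟩, inv_ne_zero ht0, ?_⟩
  · simp only [map_add, map_smul, LinearMap.add_apply, LinearMap.smul_apply, smul_eq_mul, ha, hc,
      hk, hca]
    field_simp
    ring
  · simp only [map_add, map_smul, LinearMap.add_apply, LinearMap.smul_apply, smul_eq_mul, ha, hc,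
      hk, hca]
    field_simp
    ring
  · rw [LinearEquiv.mul_apply, hsc, hsa, hxy]
    simp only [map_add, map_sub, map_smul, LinearMap.sub_apply, LinearMap.smul_apply, smul_eq_mul,
      hk]
    match_scalars
    · ring
    · field_simp
      ring
    · field_simp
      ring
  · rw [hsa]
    simp only [map_add, map_smul, LinearMap.add_apply, LinearMap.smul_apply, smul_eq_mul, ha, hca]
    match_scalars
    · field_simp
      ring
    · field_simp

open Filter in
theorem eventually_add_pow_ne_zero {lam P : ℝ} (hlam : 1 < lam) (hP : P ≠ 0) (A Q : ℝ) :
    ∀ᶠ n : ℕ in atTop, A + (lam ^ n - 1) * P + ((lam ^ n)⁻¹ - 1) * Q ≠ 0 := by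
  have hlim := tendsto_pow_atTop_atTop_of_one_lt hlam
  filter_upwards [hlim.eventually_gt_atTop ((|A| + |P| + |Q|) / |P|)] with n hn hzero
  rw [div_lt_iff₀ (abs_pos.mpr hP)] at hn
  have hpow : 1 ≤ lam ^ n := one_le_pow₀ hlam.le
  have hinv : |(lam ^ n)⁻¹ - 1| ≤ 1 := by
    have h1 : (lam ^ n)⁻¹ ≤ 1 := inv_le_one_of_one_le₀ hpow
    have h2 : 0 < (lam ^ n)⁻¹ := by positivity
    rw [abs_le]; constructor <;> linarith
  have heq : lam ^ n * P = -A + P - ((lam ^ n)⁻¹ - 1) * Q := by linear_combination hzero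
  have habs : lam ^ n * |P| = |-A + P - ((lam ^ n)⁻¹ - 1) * Q| := by
    rw [← heq, abs_mul, abs_of_nonneg (by positivity : 0 ≤ lam ^ n)]
  have h1 := abs_sub (-A + P) (((lam ^ n)⁻¹ - 1) * Q)
  have h2 := abs_add_le (-A) P
  rw [abs_neg] at h2
  rw [abs_mul] at h1
  have h3 : |(lam ^ n)⁻¹ - 1| * |Q| ≤ 1 * |Q| := by gcongr
  linarith

/-- If an isometry `k` moves the attracting line of a boost off the two orthogonal hyperplanes of
its axis, then some composite of `k` with powers of the boost puts the whole axis in general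
position. -/
theorem IsBoost.exists_transverse {b : V →ₗ[ℝ] V →ₗ[ℝ] ℝ} (hb : ∀ v w, b v w = b w v)
    {g s k : V ≃ₗ[ℝ] V} {x y : V} {lam t : ℝ} (hg : IsBoost b g x y lam)
    (hs : ∀ u v, b (s u) (s v) = b u v) (hk : ∀ u v, b (k u) (k v) = b u v) (ht : t ≠ 0)
    (hsy : s y = t • x) (hx : b x (k x) ≠ 0) (hy : b y (k x) ≠ 0) :
    ∃ n : ℕ, ∀ z ∈ ({x, y} : Set V), ∀ z' ∈ ({x, y} : Set V),
      b z ((k * g ^ n * s⁻¹ * k⁻¹) z') ≠ 0 := by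
  have hinv : ∀ {f : V ≃ₗ[ℝ] V}, (∀ u v, b (f u) (f v) = b u v) → ∀ u v, b (f⁻¹ u) v = b u (f v) :=
    fun {f} hf u v => by
      rw [← hf, ← LinearEquiv.mul_apply, mul_inv_cancel, LinearEquiv.coe_one, id]
  have hkx : ∀ z ∈ ({x, y} : Set V), b z (k x) ≠ 0 := by
    rintro z (rfl | rfl)
    exacts [hx, hy]
  have key : ∀ z ∈ ({x, y} : Set V), ∀ z' ∈ ({x, y} : Set V),
      ∀ᶠ n : ℕ in Filter.atTop, b z ((k * g ^ n * s⁻¹ * k⁻¹) z') ≠ 0 := by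
    intro z hz z' hz'
    set v := s⁻¹ (k⁻¹ z') with hv
    have hvy : b v y ≠ 0 := by
      rw [hv, hinv hs, hinv hk, hsy, map_smul, map_smul, smul_eq_mul]
      exact mul_ne_zero ht (hkx z' hz')
    have hzx : b (k⁻¹ z) x ≠ 0 := by rw [hinv hk]; exact hkx z hz
    filter_upwards [eventually_add_pow_ne_zero hg.one_lt
      (mul_ne_zero (div_ne_zero hvy hg.pair_ne_zero) hzx) (b (k⁻¹ z) v)
      (b v x / b x y * b (k⁻¹ z) y)] with n hn
    have : b z ((k * g ^ n * s⁻¹ * k⁻¹) z') = b (k⁻¹ z) ((g ^ n) v) := by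
      rw [hinv hk, hv]; rfl
    rw [this, hg.pow_apply hb]
    simp only [map_add, map_smul, smul_eq_mul]
    convert hn using 1
    ring
  have hmx : x ∈ ({x, y} : Set V) := by simp
  have hmy : y ∈ ({x, y} : Set V) := by simp
  obtain ⟨n, ⟨h1, h2⟩, h3, h4⟩ := (((key x hmx x hmx).and (key x hmx y hmy)).and
    ((key y hmy x hmx).and (key y hmy y hmy))).exists
  refine ⟨n, ?_⟩
  rintro z (rfl | rfl) z' (rfl | rfl) <;> assumption

/-- Suppose every root is either orthogonal to the axis of a boost `g` or its reflection swaps the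
eigenlines of `g` up to orthogonality. Then roots of the second kind pair through their
projections to the axis. -/
theorem IsBoost.pairing_eq {b : V →ₗ[ℝ] V →ₗ[ℝ] ℝ} (hb : ∀ v w, b v w = b w v) {Φ : Set V}
    (hrefl : ∀ γ ∈ Φ, ∀ δ ∈ Φ, γ - (2 * b γ δ) • δ ∈ Φ) {g : V ≃ₗ[ℝ] V} {x y : V} {lam : ℝ}
    (hg : IsBoost b g x y lam) (hgΦ : ∀ γ ∈ Φ, g γ ∈ Φ)
    (htype : ∀ γ ∈ Φ, (b x γ = 0 ∧ b y γ = 0) ∨ 2 * (b x γ * b y γ) = b x y)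
    {γ δ : V} (hγ : γ ∈ Φ) (hδ : δ ∈ Φ) (hγt : 2 * (b x γ * b y γ) = b x y)
    (hδt : 2 * (b x δ * b y δ) = b x y) :
    b γ δ = (b x γ * b y δ + b y γ * b x δ) / b x y := by
  have hc := hg.pair_ne_zero
  by_contra hne
  set e := b γ δ - (b x γ * b y δ + b y γ * b x δ) / b x y with he
  have he0 : e ≠ 0 := sub_ne_zero.mpr hne
  have hgn : ∀ n : ℕ, (g ^ n) δ ∈ Φ := by
    intro n
    induction n with
    | zero => simpa using hδ
    | succ n ih => rw [pow_succ', LinearEquiv.mul_apply]; exact hgΦ _ ih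
  have hP : b x γ * b y δ / b x y ≠ 0 := by
    refine div_ne_zero (mul_ne_zero ?_ ?_) hc
    · intro h; rw [h] at hγt; simp at hγt; exact hc hγt.symm
    · intro h; rw [h] at hδt; simp at hδt; exact hc hδt.symm
  have hbn : ∀ n : ℕ, b γ ((g ^ n) δ) = b γ δ + (lam ^ n - 1) * (b x γ * b y δ / b x y)
      + ((lam ^ n)⁻¹ - 1) * (b y γ * b x δ / b x y) := fun n => by
    rw [hg.pow_apply hb]
    simp only [map_add, map_smul, smul_eq_mul, hb γ x, hb γ y, hb δ x, hb δ y]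
    ring
  obtain ⟨n, hn0, hn1⟩ := ((eventually_add_pow_ne_zero hg.one_lt hP (b γ δ)
    (b y γ * b x δ / b x y)).and (eventually_add_pow_ne_zero hg.one_lt hP (b γ δ + 1 / (4 * e))
    (b y γ * b x δ / b x y))).exists
  have hlam : lam ^ n ≠ 0 := pow_ne_zero _ (by linarith [hg.one_lt] : 0 < lam).ne'
  have hx : b x ((g ^ n) δ) = (lam ^ n)⁻¹ * b x δ := by
    rw [hg.pow_apply hb]
    simp only [map_add, map_smul, smul_eq_mul, hb δ x, hg.left_isotropic]
    field_simp
    ring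
  have hy : b y ((g ^ n) δ) = lam ^ n * b y δ := by
    rw [hg.pow_apply hb]
    simp only [map_add, map_smul, smul_eq_mul, hb δ y, hg.right_isotropic, hb y x]
    field_simp
    ring
  set β := b γ ((g ^ n) δ) with hβ
  have hβe : β - e = (lam ^ n * (b x γ * b y δ) + (lam ^ n)⁻¹ * (b y γ * b x δ)) / b x y := by
    rw [hβ, hbn, he]; ring
  have hβ0 : β ≠ 0 := by rw [hβ, hbn]; exact hn0
  have hβ1 : 4 * β * e + 1 ≠ 0 := by
    intro h
    apply hn1
    have : β + 1 / (4 * e) = 0 := by field_simp; linear_combination h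
    rw [hβ, hbn] at this
    linear_combination this
  have hprod : 2 * (b x (γ - (2 * β) • (g ^ n) δ) * b y (γ - (2 * β) • (g ^ n) δ))
      = b x y * (1 + 4 * β * e) := by
    simp only [map_sub, map_smul, smul_eq_mul, hx, hy]
    have h1 : lam ^ n * (b x γ * b y δ) + (lam ^ n)⁻¹ * (b y γ * b x δ) = (β - e) * b x y := by
      rw [hβe]; field_simp
    have h2 : (lam ^ n)⁻¹ * lam ^ n = 1 := inv_mul_cancel₀ hlam
    linear_combination hγt - 4 * β * h1 + 8 * β ^ 2 * b x δ * b y δ * h2 + 4 * β ^ 2 * hδt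
  rcases htype _ (hrefl γ hγ _ (hgn n)) with ⟨h1, -⟩ | h
  · rw [← hβ] at h1
    rw [h1, zero_mul, mul_zero] at hprod
    exact hβ1 (by linarith [(mul_eq_zero.mp hprod.symm).resolve_left hc])
  · rw [← hβ, hprod] at h
    have : b x y * (4 * (β * e)) = 0 := by linear_combination h
    simp [hc, hβ0, he0] at this

/-- The reflection `v ↦ v - 2 b(v, a) a` in a unit vector `a`. -/
noncomputable def unitReflection (b : V →ₗ[ℝ] V →ₗ[ℝ] ℝ) (a : V) (ha : b a a = 1) : V ≃ₗ[ℝ] V :=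
  Module.reflection (x := a) (f := (2 : ℝ) • b.flip a) (by simp [ha])

theorem unitReflection_apply {b : V →ₗ[ℝ] V →ₗ[ℝ] ℝ} {a : V} (ha : b a a = 1) (v : V) :
    unitReflection b a ha v = v - (2 * b v a) • a := by
  simp [unitReflection, Module.reflection_apply]

theorem unitReflection_mul_self {b : V →ₗ[ℝ] V →ₗ[ℝ] ℝ} {a : V} (ha : b a a = 1) :
    unitReflection b a ha * unitReflection b a ha = 1 := by
  ext v
  simp only [LinearEquiv.mul_apply, unitReflection_apply, map_sub, map_smul, ha,
    LinearEquiv.coe_one, id_eq]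
  module

theorem unitReflection_isometry {b : V →ₗ[ℝ] V →ₗ[ℝ] ℝ} (hb : ∀ v w, b v w = b w v) {a : V}
    (ha : b a a = 1) (v w : V) :
    b (unitReflection b a ha v) (unitReflection b a ha w) = b v w := by
  simp only [unitReflection_apply, map_sub, map_smul, LinearMap.sub_apply,
    LinearMap.smul_apply, smul_eq_mul, ha, hb a]
  ring

theorem unitReflection_mul_pow_apply {b : V →ₗ[ℝ] V →ₗ[ℝ] ℝ} (hb : ∀ v w, b v w = b w v)
    {a c : V} (ha : b a a = 1) (hc : b c c = 1) {R : ℕ → ℝ} (h0 : R 0 = 0) (h1 : R 1 = 1)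
    (hR : ∀ k, R (k + 2) = -2 * b a c * R (k + 1) - R k) (k : ℕ) :
    ((unitReflection b a ha * unitReflection b c hc) ^ k) a
      = R (2 * k + 1) • a + R (2 * k) • c := by
  induction k with
  | zero => simp [h0, h1]
  | succ k ih =>
    rw [pow_succ', LinearEquiv.mul_apply, ih, LinearEquiv.mul_apply]
    simp only [unitReflection_apply, map_sub, map_add, map_smul, ha, hc, hb c a]
    rw [show 2 * (k + 1) + 1 = 2 * k + 1 + 2 by ring, show 2 * (k + 1) = 2 * k + 2 by ring, hR,
      show 2 * k + 1 + 1 = 2 * k + 2 by ring, hR]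
    module

/-- The product of two unit reflections has finite order as soon as it does on their plane. -/
theorem unitReflection_mul_pow_eq_one {b : V →ₗ[ℝ] V →ₗ[ℝ] ℝ} (hb : ∀ v w, b v w = b w v)
    {a c : V} (ha : b a a = 1) (hc : b c c = 1) (hac : b a c ^ 2 ≠ 1) {m : ℕ} {R : ℕ → ℝ}
    (h0 : R 0 = 0) (h1 : R 1 = 1) (hR : ∀ k, R (k + 2) = -2 * b a c * R (k + 1) - R k)
    (hm : R (2 * m) = 0) (hm' : R (2 * m + 1) = 1) :
    (unitReflection b a ha * unitReflection b c hc) ^ m = 1 := by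
  set f := (unitReflection b a ha * unitReflection b c hc) ^ m with hf
  have hfa : f a = a := by
    rw [hf, unitReflection_mul_pow_apply hb ha hc h0 h1 hR, hm, hm']; simp
  have hfc : f c = c := by
    have h := unitReflection_mul_pow_apply hb hc ha h0 h1 (by simpa only [hb c a] using hR) m
    rw [hm, hm', one_smul, zero_smul, add_zero] at h
    have hinv : f * (unitReflection b c hc * unitReflection b a ha) ^ m = 1 := by
      have : (unitReflection b c hc * unitReflection b a ha)
          = (unitReflection b a ha * unitReflection b c hc)⁻¹ := by
        rw [mul_inv_rev, inv_eq_of_mul_eq_one_left (unitReflection_mul_self ha),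
          inv_eq_of_mul_eq_one_left (unitReflection_mul_self hc)]
      rw [this, hf, inv_pow, mul_inv_cancel]
    conv_lhs => rw [← h]
    rw [← LinearEquiv.mul_apply, hinv, LinearEquiv.coe_one, id]
  have hperp : ∀ v, b v a = 0 → b v c = 0 → f v = v := by
    intro v hva hvc
    have hfix : (unitReflection b a ha * unitReflection b c hc) v = v := by
      simp [LinearEquiv.mul_apply, unitReflection_apply, hva, hvc]
    rw [hf]
    clear hf hfa hfc hm hm'
    clear f
    induction m with
    | zero => simp
    | succ m ih => rw [pow_succ', LinearEquiv.mul_apply, ih, hfix]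
  ext v
  have hd : 1 - b a c ^ 2 ≠ 0 := sub_ne_zero.mpr hac.symm
  set p := (b v a - b a c * b v c) / (1 - b a c ^ 2) with hp
  set q := (b v c - b a c * b v a) / (1 - b a c ^ 2) with hq
  have key : f (v - p • a - q • c) = v - p • a - q • c := by
    apply hperp
    · simp only [map_sub, map_smul, LinearMap.sub_apply, LinearMap.smul_apply, smul_eq_mul, ha,
        hb c a, hp, hq]
      field_simp
      ring
    · simp only [map_sub, map_smul, LinearMap.sub_apply, LinearMap.smul_apply, smul_eq_mul, hc,
        hp, hq]
      field_simp
      ring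
  simp only [map_sub, map_smul, hfa, hfc] at key
  simpa using key

end Boost

/-- A set with a map to a proper metric space which is uniformly separated and bounded is finite. -/
theorem Set.Finite.of_bounded_of_separated {α E : Type*} [PseudoMetricSpace E] [ProperSpace E]
    {S : Set α} {f : α → E} (hbdd : Bornology.IsBounded (f '' S)) {ε : ℝ} (hε : 0 < ε)
    (hsep : ∀ a ∈ S, ∀ a' ∈ S, a ≠ a' → ε ≤ dist (f a) (f a')) : S.Finite := by
  classical
  obtain ⟨t, ht, hcov⟩ := Metric.totallyBounded_iff.mp
    (hbdd.isCompact_closure.totallyBounded.subset subset_closure) (ε / 2) (half_pos hε)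
  have hy : ∀ a : α, ∃ y, a ∈ S → y ∈ t ∧ dist (f a) y < ε / 2 := by
    intro a
    by_cases ha : a ∈ S
    · obtain ⟨y, hy, h⟩ := Set.mem_iUnion₂.mp (hcov (Set.mem_image_of_mem f ha))
      exact ⟨y, fun _ => ⟨hy, h⟩⟩
    · exact ⟨f a, fun h => absurd h ha⟩
  choose y hy using hy
  refine Set.Finite.of_injOn (f := y) (fun a ha => (hy a ha).1) ?_ ht
  intro a ha a' ha' hyy
  by_contra hne
  have h1 := hsep a ha a' ha' hne
  have h2 := dist_triangle_right (f a) (f a') (y a)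
  have h3 := (hy a ha).2
  have h4 := (hy a' ha').2
  rw [← hyy] at h4
  linarith

/-- The quadratic form of a real matrix attains its minimum on the unit sphere. -/
theorem Matrix.exists_min_quadratic {B : Type*} [Fintype B] [Nonempty B] (A : Matrix B B ℝ) :
    ∃ (μ : ℝ) (x : B → ℝ), x ≠ 0 ∧ x ⬝ᵥ A.mulVec x = μ * (x ⬝ᵥ x) ∧
      ∀ v, μ * (v ⬝ᵥ v) ≤ v ⬝ᵥ A.mulVec v := by
  classical
  let S : Set (B → ℝ) := {v | v ⬝ᵥ v = 1}
  have hcont : Continuous fun v : B → ℝ => v ⬝ᵥ v := by fun_prop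
  have hcont' : Continuous fun v : B → ℝ => v ⬝ᵥ A.mulVec v := by fun_prop
  have hS : IsCompact S := by
    refine Metric.isCompact_of_isClosed_isBounded (isClosed_eq hcont continuous_const) ?_
    refine (Metric.isBounded_closedBall (x := (0 : B → ℝ)) (r := 1)).subset fun v hv => ?_
    rw [mem_closedBall_zero_iff, pi_norm_le_iff_of_nonneg zero_le_one]
    intro i
    rw [Real.norm_eq_abs, ← sq_le_one_iff_abs_le_one, ← (hv : v ⬝ᵥ v = 1), sq]
    exact Finset.single_le_sum (f := fun i => v i * v i) (fun i _ => mul_self_nonneg _)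
      (Finset.mem_univ i)
  obtain ⟨x, hx, hmin⟩ := hS.exists_isMinOn
    ⟨Pi.single (Classical.arbitrary B) 1, by simp [S]⟩ hcont'.continuousOn
  refine ⟨x ⬝ᵥ A.mulVec x, x, ?_, ?_, fun v => ?_⟩
  · rintro rfl
    simp [S] at hx
  · rw [(hx : x ⬝ᵥ x = 1), mul_one]
  · by_cases hv : v = 0
    · simp [hv]
    have hpos : 0 < v ⬝ᵥ v := by
      have h1 := Finset.sum_nonneg fun i (_ : i ∈ Finset.univ) => mul_self_nonneg (v i)
      exact lt_of_le_of_ne h1 fun h => hv (dotProduct_self_eq_zero.mp h.symm)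
    have hr := Real.sqrt_pos.mpr hpos
    have hrr := Real.mul_self_sqrt hpos.le
    set r := √(v ⬝ᵥ v)
    have hmem : r⁻¹ • v ∈ S := by
      change (r⁻¹ • v) ⬝ᵥ (r⁻¹ • v) = 1
      rw [smul_dotProduct, dotProduct_smul, ← hrr, smul_eq_mul, smul_eq_mul]
      field_simp
    have h := hmin hmem
    simp only [Set.mem_ofPred_eq, Matrix.mulVec_smul, smul_dotProduct, dotProduct_smul,
      smul_eq_mul] at h
    rw [← hrr]
    calc _ ≤ (r⁻¹ * (r⁻¹ * (v ⬝ᵥ A.mulVec v))) * (r * r) := by gcongr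
      _ = v ⬝ᵥ A.mulVec v := by field_simp

section CoxeterForm

variable {B : Type*} [Fintype B]

/-- The canonical symmetric bilinear form of a Coxeter matrix. -/
noncomputable def coxeterForm (M : CoxeterMatrix B) : (B → ℝ) →ₗ[ℝ] (B → ℝ) →ₗ[ℝ] ℝ := by
  classical exact Matrix.toBilin' (coxeterBilinMatrix M)

open Classical in
/-- The simple roots of the geometric representation. -/
noncomputable def simpleRoot {B : Type*} (i : B) : B → ℝ := Pi.single i 1

theorem simpleRoot_nonneg {B : Type*} (i : B) : 0 ≤ (simpleRoot i : B → ℝ) := by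
  classical
  intro j
  simp only [simpleRoot, Pi.zero_apply, Pi.single_apply]
  split_ifs <;> norm_num

theorem coxeterForm_apply (M : CoxeterMatrix B) (v w : B → ℝ) :
    coxeterForm M v w = v ⬝ᵥ (coxeterBilinMatrix M).mulVec w := by
  classical exact Matrix.toBilin'_apply' _ _ _

theorem coxeterForm_simpleRoot (M : CoxeterMatrix B) (i j : B) :
    coxeterForm M (simpleRoot i) (simpleRoot j) = coxeterBilinMatrix M i j := by
  classical
  simp [coxeterForm_apply, simpleRoot]

theorem coxeterBilinMatrix_symm (M : CoxeterMatrix B) (i j : B) :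
    coxeterBilinMatrix M i j = coxeterBilinMatrix M j i := by
  simp [coxeterBilinMatrix, M.symmetric i j]

theorem coxeterForm_symm (M : CoxeterMatrix B) (v w : B → ℝ) :
    coxeterForm M v w = coxeterForm M w v := by
  have : (coxeterBilinMatrix M).transpose = coxeterBilinMatrix M := by
    ext i j; exact coxeterBilinMatrix_symm M j i
  rw [coxeterForm_apply, coxeterForm_apply, Matrix.dotProduct_mulVec, dotProduct_comm,
    ← Matrix.mulVec_transpose, this]

theorem coxeterForm_simpleRoot_self (M : CoxeterMatrix B) (i : B) :
    coxeterForm M (simpleRoot i) (simpleRoot i) = 1 := by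
  simp [coxeterForm_simpleRoot, coxeterBilinMatrix]

theorem sum_smul_simpleRoot (v : B → ℝ) : ∑ i, v i • simpleRoot i = v := by
  classical
  ext j
  simp [simpleRoot, Finset.sum_apply, Pi.single_apply]

theorem CoxeterMatrix.two_le_of_ne {B : Type*} (M : CoxeterMatrix B) {i j : B} (hij : i ≠ j) (h0 : M i j ≠ 0) :
    2 ≤ M i j := by
  have := M.off_diagonal i j hij
  omega

theorem coxeterBilinMatrix_nonpos (M : CoxeterMatrix B) {i j : B} (hij : i ≠ j) :
    coxeterBilinMatrix M i j ≤ 0 := by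
  unfold coxeterBilinMatrix
  split_ifs with h
  · norm_num
  · have hm : (2 : ℝ) ≤ M i j := by exact_mod_cast M.two_le_of_ne hij h
    have h1 : Real.pi / M i j ≤ Real.pi / 2 := by gcongr
    have h2 : 0 ≤ Real.pi / M i j := by positivity
    linarith [Real.cos_nonneg_of_mem_Icc ⟨by linarith [Real.pi_pos], h1⟩]

theorem neg_one_le_coxeterBilinMatrix (M : CoxeterMatrix B) (i j : B) :
    -1 ≤ coxeterBilinMatrix M i j := by
  unfold coxeterBilinMatrix
  split_ifs with h
  · norm_num
  · linarith [Real.cos_le_one (Real.pi / M i j)]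

theorem coxeterBilinMatrix_neg_of_adj {M : CoxeterMatrix B} {i j : B}
    (hij : (coxeterGraph M).Adj i j) : coxeterBilinMatrix M i j < 0 := by
  simp only [coxeterGraph, SimpleGraph.fromRel_adj, M.symmetric j i, or_self] at hij
  unfold coxeterBilinMatrix
  split_ifs with h
  · norm_num
  · have h3 : 3 ≤ M i j := by have := M.two_le_of_ne hij.1 h; have := hij.2; omega
    have hm : (3 : ℝ) ≤ M i j := by exact_mod_cast h3
    have h1 : Real.pi / M i j ≤ Real.pi / 3 := by gcongr
    have h2 : 0 ≤ Real.pi / M i j := by positivity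
    have hp := Real.pi_pos
    linarith [Real.cos_pos_of_mem_Ioo (x := Real.pi / M i j) ⟨by linarith, by linarith⟩]

/-- The coefficients describing the action of a rank two Coxeter group on its simple roots. -/
theorem exists_dihedral_coefficients (M : CoxeterMatrix B) {i j : B} (hij : i ≠ j) :
    ∃ R : ℕ → ℝ, R 0 = 0 ∧ R 1 = 1 ∧
      (∀ k, R (k + 2) = -2 * coxeterBilinMatrix M i j * R (k + 1) - R k) ∧
      (∀ k, (M i j ≠ 0 → k ≤ M i j) → 0 ≤ R k) ∧
      (M i j ≠ 0 → R (2 * M i j) = 0 ∧ R (2 * M i j + 1) = 1 ∧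
        coxeterBilinMatrix M i j ^ 2 ≠ 1) := by
  by_cases h : M i j = 0
  · refine ⟨fun k => k, by simp, by simp, fun k => ?_, fun k _ => Nat.cast_nonneg k,
      fun h' => absurd h h'⟩
    simp [coxeterBilinMatrix, h]
    ring
  · have h2 := M.two_le_of_ne hij h
    have hm : (2 : ℝ) ≤ M i j := by exact_mod_cast h2
    have hp := Real.pi_pos
    set θ := Real.pi / M i j with hθ
    have hθ0 : 0 < θ := by positivity
    have hθ1 : θ ≤ Real.pi / 2 := by rw [hθ]; gcongr
    have hs : 0 < Real.sin θ := Real.sin_pos_of_pos_of_lt_pi hθ0 (by linarith)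
    have hmθ : (M i j : ℝ) * θ = Real.pi := by rw [hθ]; field_simp
    have hB : coxeterBilinMatrix M i j = -Real.cos θ := by simp [coxeterBilinMatrix, h, hθ]
    refine ⟨fun k => Real.sin (k * θ) / Real.sin θ, by simp, by simp [hs.ne'], fun k => ?_,
      fun k hk => ?_, fun _ => ⟨?_, ?_, ?_⟩⟩
    · rw [hB]
      have e1 : ((k + 2 : ℕ) : ℝ) * θ = ((k + 1 : ℕ) : ℝ) * θ + θ := by push_cast; ring
      have e2 : (k : ℝ) * θ = ((k + 1 : ℕ) : ℝ) * θ - θ := by push_cast; ring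
      simp only [e1, e2, Real.sin_add, Real.sin_sub]
      field_simp
      ring
    · have : (k : ℝ) * θ ≤ Real.pi := by
        rw [← hmθ]; gcongr; exact hk h
      exact div_nonneg (Real.sin_nonneg_of_nonneg_of_le_pi (by positivity) this) hs.le
    · have : ((2 * M i j : ℕ) : ℝ) * θ = 2 * Real.pi := by push_cast; rw [mul_assoc, hmθ]
      simp only [this, Real.sin_two_pi, zero_div]
    · have : ((2 * M i j + 1 : ℕ) : ℝ) * θ = θ + 2 * Real.pi := by
        push_cast; linear_combination 2 * hmθ
      simp only [this, Real.sin_add_two_pi, div_self hs.ne']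
    · rw [hB]
      intro hc
      nlinarith [Real.sin_sq_add_cos_sq θ]

theorem coxeterMatrix_isLiftable_unitReflection (M : CoxeterMatrix B) :
    M.IsLiftable fun i => unitReflection (coxeterForm M) (simpleRoot i)
      (coxeterForm_simpleRoot_self M i) := by
  intro i j
  by_cases hij : i = j
  · subst hij
    simp [unitReflection_mul_self]
  by_cases h : M i j = 0
  · simp [h]
  obtain ⟨R, h0, h1, hR, -, hm⟩ := exists_dihedral_coefficients M hij
  rw [← coxeterForm_simpleRoot] at hR hm
  exact unitReflection_mul_pow_eq_one (coxeterForm_symm M) _ _ (hm h).2.2 h0 h1 hR (hm h).1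
    (hm h).2.1

theorem coxeterForm_simpleRoot_left (M : CoxeterMatrix B) (i : B) (v : B → ℝ) :
    coxeterForm M (simpleRoot i) v = (coxeterBilinMatrix M).mulVec v i := by
  classical
  rw [coxeterForm_apply, simpleRoot, single_one_dotProduct]

theorem coxeterForm_eq_sum (M : CoxeterMatrix B) (u v : B → ℝ) :
    coxeterForm M u v = ∑ i, v i * coxeterForm M u (simpleRoot i) := by
  conv_lhs => rw [← sum_smul_simpleRoot v]
  simp only [map_sum, map_smul, smul_eq_mul]

theorem exists_norm_coxeterForm_le (M : CoxeterMatrix B) :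
    ∃ K, 0 < K ∧ ∀ u v, |coxeterForm M u v| ≤ K * ‖u‖ * ‖v‖ := by
  refine ⟨‖(coxeterForm M).toContinuousBilinearMap‖ + 1, by positivity, fun u v => ?_⟩
  refine ((coxeterForm M).toContinuousBilinearMap.le_opNorm₂ u v).trans ?_
  gcongr
  linarith

/-- Perron–Frobenius: an indefinite Coxeter form has a positive vector in the open
antidominant cone. -/
theorem exists_pos_antidominant {M : CoxeterMatrix B} (hconn : (coxeterGraph M).Connected)
    (hM : ¬ (coxeterBilinMatrix M).PosSemidef) :
    ∃ u : B → ℝ, (∀ i, 0 < u i) ∧ ∀ i, coxeterForm M u (simpleRoot i) < 0 := by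
  classical
  have := hconn.nonempty
  set A := coxeterBilinMatrix M with hA
  obtain ⟨μ, x, hx0, hxμ, hmin⟩ := A.exists_min_quadratic
  have hherm : A.IsHermitian := by
    ext i j; simpa using coxeterBilinMatrix_symm M j i
  have hμ : μ < 0 := by
    by_contra h
    push Not at h
    apply hM
    rw [Matrix.posSemidef_iff_dotProduct_mulVec]
    refine ⟨hherm, fun v => ?_⟩
    rw [star_trivial]
    exact (mul_nonneg h (dotProduct_self_star_nonneg v)).trans (hmin v)
  set z : B → ℝ := fun i => |x i| with hz
  have hzz : z ⬝ᵥ z = x ⬝ᵥ x := by simp [dotProduct, hz, abs_mul_abs_self]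
  have hzA : z ⬝ᵥ A.mulVec z ≤ x ⬝ᵥ A.mulVec x := by
    simp only [dotProduct, Matrix.mulVec, Finset.mul_sum]
    refine Finset.sum_le_sum fun i _ => Finset.sum_le_sum fun j _ => ?_
    by_cases hij : i = j
    · subst hij
      have h := abs_mul_abs_self (x i)
      simp only [hz]
      exact le_of_eq (by linear_combination A i i * h)
    · have h1 := coxeterBilinMatrix_nonpos M hij
      have h2 := le_abs_self (x i * x j)
      rw [abs_mul] at h2
      simp only [hz]
      nlinarith
  have hPSD : (A - μ • 1).PosSemidef := by
    rw [Matrix.posSemidef_iff_dotProduct_mulVec]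
    refine ⟨?_, fun v => ?_⟩
    · ext i j
      have := hherm.apply i j
      simp only [star_trivial] at this
      simp [this, Matrix.one_apply, eq_comm]
    · have := hmin v
      simp only [star_trivial, Matrix.sub_mulVec, Matrix.smul_mulVec, Matrix.one_mulVec,
        dotProduct_sub, dotProduct_smul, smul_eq_mul]
      linarith
  have heig : A.mulVec z = μ • z := by
    have h0 : star z ⬝ᵥ (A - μ • 1).mulVec z = 0 := by
      have := hmin z
      simp only [star_trivial, Matrix.sub_mulVec, Matrix.smul_mulVec, Matrix.one_mulVec,
        dotProduct_sub, dotProduct_smul, smul_eq_mul]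
      rw [hzz] at this ⊢
      linarith
    rw [hPSD.dotProduct_mulVec_zero_iff] at h0
    simpa [Matrix.sub_mulVec, Matrix.smul_mulVec, sub_eq_zero] using h0
  have hznn : ∀ i, 0 ≤ z i := fun i => abs_nonneg _
  have hprop : ∀ i j, (coxeterGraph M).Adj i j → z i = 0 → z j = 0 := by
    intro i j hij hi
    have hsum : ∑ k, A i k * z k = 0 := by
      have := congrFun heig i
      simpa [Matrix.mulVec, dotProduct, hi] using this
    have hterm : ∀ k ∈ Finset.univ, A i k * z k ≤ 0 := by
      intro k _
      by_cases hik : i = k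
      · subst hik; simp [hi]
      · exact mul_nonpos_of_nonpos_of_nonneg (coxeterBilinMatrix_nonpos M hik) (hznn k)
    have := (Finset.sum_eq_zero_iff_of_nonpos hterm).mp hsum j (Finset.mem_univ j)
    exact (mul_eq_zero.mp this).resolve_left (coxeterBilinMatrix_neg_of_adj hij).ne
  have hzpos : ∀ i, 0 < z i := by
    intro i
    refine lt_of_le_of_ne (hznn i) fun hi => hx0 ?_
    ext j
    obtain ⟨p⟩ := hconn.preconnected i j
    have : z j = 0 := by
      replace hi := hi.symm
      induction p with
      | nil => exact hi
      | cons hadj _ ih => exact ih (hprop _ _ hadj hi)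
    simpa [hz] using this
  refine ⟨z, hzpos, fun i => ?_⟩
  rw [coxeterForm_symm, coxeterForm_simpleRoot_left, ← hA, heig]
  exact mul_neg_of_neg_of_pos hμ (hzpos i)

end CoxeterForm

namespace CoxeterSystem

variable {B : Type*} [Fintype B] {W : Type*} [Group W] {M : CoxeterMatrix B}
  (cs : CoxeterSystem M W)

/-- The geometric representation of a Coxeter group. -/
noncomputable def geomRep : W →* ((B → ℝ) ≃ₗ[ℝ] (B → ℝ)) :=
  cs.lift ⟨_, coxeterMatrix_isLiftable_unitReflection M⟩

theorem geomRep_simple (i : B) : cs.geomRep (cs.simple i)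
    = unitReflection (coxeterForm M) (simpleRoot i) (coxeterForm_simpleRoot_self M i) :=
  cs.lift_apply_simple (coxeterMatrix_isLiftable_unitReflection M) i

theorem geomRep_simple_apply (i : B) (v : B → ℝ) : cs.geomRep (cs.simple i) v
    = v - (2 * coxeterForm M v (simpleRoot i)) • simpleRoot i := by
  rw [geomRep_simple, unitReflection_apply]

theorem geomRep_mul_apply (w w' : W) (v : B → ℝ) :
    cs.geomRep (w * w') v = cs.geomRep w (cs.geomRep w' v) := by
  rw [map_mul, LinearEquiv.mul_apply]

theorem geomRep_inv_apply_self (w : W) (v : B → ℝ) :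
    cs.geomRep w⁻¹ (cs.geomRep w v) = v := by
  rw [← geomRep_mul_apply]; simp

theorem geomRep_apply_inv_self (w : W) (v : B → ℝ) :
    cs.geomRep w (cs.geomRep w⁻¹ v) = v := by
  rw [← geomRep_mul_apply]; simp

theorem coxeterForm_geomRep (w : W) (v v' : B → ℝ) :
    coxeterForm M (cs.geomRep w v) (cs.geomRep w v') = coxeterForm M v v' := by
  induction w using cs.simple_induction generalizing v v' with
  | simple i => rw [geomRep_simple]; exact unitReflection_isometry (coxeterForm_symm M) _ _ _
  | one => simp
  | mul w w' h h' => rw [geomRep_mul_apply, geomRep_mul_apply, h, h']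

theorem coxeterForm_geomRep_left (w : W) (v v' : B → ℝ) :
    coxeterForm M (cs.geomRep w v) v' = coxeterForm M v (cs.geomRep w⁻¹ v') := by
  rw [← cs.coxeterForm_geomRep w v, geomRep_apply_inv_self]

theorem geomRep_wordProd_alternatingWord {i j : B} {R : ℕ → ℝ} (h0 : R 0 = 0) (h1 : R 1 = 1)
    (hR : ∀ k, R (k + 2) = -2 * coxeterBilinMatrix M i j * R (k + 1) - R k) (k : ℕ) :
    cs.geomRep (cs.wordProd (alternatingWord i j k)) (simpleRoot i) =
      if Even k then R (k + 1) • simpleRoot i + R k • simpleRoot j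
        else R k • simpleRoot i + R (k + 1) • simpleRoot j := by
  induction k with
  | zero => simp [alternatingWord, h0, h1]
  | succ k ih =>
    rw [alternatingWord_succ', wordProd_cons, geomRep_mul_apply, ih]
    have hji := coxeterBilinMatrix_symm M j i
    by_cases hk : Even k
    · have hk' : ¬ Even (k + 1) := by rw [Nat.even_add_one]; simpa using hk
      simp only [hk, hk', if_true, if_false, geomRep_simple_apply, map_add, map_smul,
        coxeterForm_simpleRoot_self, coxeterForm_simpleRoot, hR]
      module
    · have hk' : Even (k + 1) := by rw [Nat.even_add_one]; simpa using hk
      simp only [hk, hk', if_true, if_false, geomRep_simple_apply, map_add, map_smul,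
        coxeterForm_simpleRoot_self, coxeterForm_simpleRoot, hR, hji]
      module

/-- If `s` is not a right descent of `w`, then no reduced factorization of `w` ends in the longest
element of the dihedral group of `s` and `t`. -/
theorem length_ne_of_not_isRightDescent {B W : Type*} [Group W] {M : CoxeterMatrix B}
    (cs : CoxeterSystem M W) {w v : W} {s t : B} (hs : ¬ cs.IsRightDescent w s)
    (hm : M s t ≠ 0) (hw : w = v * cs.wordProd (alternatingWord s t (M s t))) :
    cs.length w ≠ cs.length v + M s t := by
  intro hlen
  obtain ⟨m, hm'⟩ := Nat.exists_eq_succ_of_ne_zero hm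
  have hbraid : cs.wordProd (alternatingWord s t (M s t))
      = cs.wordProd (alternatingWord s t m) * cs.simple s := by
    have := cs.wordProd_braidWord_eq s t
    simp only [CoxeterSystem.braidWord, M.symmetric t s] at this
    rw [this, hm', Nat.succ_eq_add_one, alternatingWord_succ, wordProd_concat]
  apply hs
  rw [IsRightDescent]
  nth_rewrite 1 [hw]
  rw [hbraid, mul_assoc, mul_assoc, simple_mul_simple_self, mul_one, hlen, hm']
  have h1 := cs.length_mul_le v (cs.wordProd (alternatingWord s t m))
  have h2 := cs.length_wordProd_le (alternatingWord s t m)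
  rw [length_alternatingWord] at h2
  omega

/-- A non-descent splits off a maximal dihedral right factor. -/
theorem exists_dihedral_factorization {B W : Type*} [Group W] {M : CoxeterMatrix B}
    (cs : CoxeterSystem M W) {w : W} {s t : B} (hs : ¬ cs.IsRightDescent w s)
    (ht : cs.IsRightDescent w t) :
    ∃ (v : W) (k : ℕ), w = v * cs.wordProd (alternatingWord s t k) ∧
      cs.length v < cs.length w ∧ (M s t ≠ 0 → k + 1 ≤ M s t) ∧
      ¬ cs.IsRightDescent v s ∧ ¬ cs.IsRightDescent v t := by
  classical
  let D : ℕ → Prop := fun k => ∃ v, w = v * cs.wordProd (alternatingWord s t k) ∧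
    cs.length w = cs.length v + k
  have hex : ∃ n, ¬ D n := ⟨cs.length w + 1, by rintro ⟨v, -, h⟩; omega⟩
  have hD0 : D 0 := ⟨w, by simp [alternatingWord], by simp⟩
  have hD1 : D 1 := ⟨w * cs.simple t, by simp [alternatingWord], by
    rw [isRightDescent_iff] at ht; exact ht.symm⟩
  obtain ⟨k, hk⟩ : ∃ k, Nat.find hex = k + 2 := by
    have h0 : Nat.find hex ≠ 0 := fun h => Nat.find_spec hex (h ▸ hD0)
    have h1 : Nat.find hex ≠ 1 := fun h => Nat.find_spec hex (h ▸ hD1)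
    exact ⟨Nat.find hex - 2, by omega⟩
  have hnot : ¬ D (k + 2) := hk ▸ Nat.find_spec hex
  obtain ⟨v, hw, hlen⟩ : D (k + 1) := not_not.mp (Nat.find_min hex (by omega))
  have hhead : ¬ cs.IsRightDescent v (if Even (k + 1) then t else s) := by
    intro h
    rw [isRightDescent_iff] at h
    refine hnot ⟨v * cs.simple (if Even (k + 1) then t else s), ?_, by omega⟩
    rw [alternatingWord_succ', wordProd_cons, ← mul_assoc, simple_mul_simple_cancel_right]
    exact hw
  have hother : ¬ cs.IsRightDescent v (if Even k then t else s) := by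
    intro h
    rw [isRightDescent_iff] at h
    rw [alternatingWord_succ', wordProd_cons, ← mul_assoc] at hw
    have h1 := cs.length_mul_le (v * cs.simple (if Even k then t else s))
      (cs.wordProd (alternatingWord s t k))
    have h2 := cs.length_wordProd_le (alternatingWord s t k)
    rw [length_alternatingWord] at h2
    rw [← hw] at h1
    omega
  refine ⟨v, k + 1, hw, by omega, fun hm => ?_, ?_⟩
  · have : ¬ D (M s t) := fun ⟨v', h1, h2⟩ => cs.length_ne_of_not_isRightDescent hs hm h1 h2
    have := Nat.find_min' hex this
    omega
  · by_cases hE : Even k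
    · have : ¬ Even (k + 1) := by rw [Nat.even_add_one]; simpa using hE
      simp only [hE, this, if_true, if_false] at hhead hother
      exact ⟨hhead, hother⟩
    · have : Even (k + 1) := by rw [Nat.even_add_one]; simpa using hE
      simp only [hE, this, if_true, if_false] at hhead hother
      exact ⟨hother, hhead⟩

/-- Tits' positivity theorem: if `s` is not a right descent of `w` then `w` maps the simple root
of `s` to a positive root. -/
theorem geomRep_simpleRoot_nonneg (w : W) (s : B) (hs : ¬ cs.IsRightDescent w s) :
    0 ≤ cs.geomRep w (simpleRoot s) := by
  induction hn : cs.length w using Nat.strong_induction_on generalizing w s with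
  | _ n ih =>
  subst hn
  by_cases hw1 : w = 1
  · subst hw1
    simpa using simpleRoot_nonneg s
  obtain ⟨t, ht⟩ := cs.exists_rightDescent_of_ne_one hw1
  have hst : s ≠ t := by rintro rfl; exact hs ht
  obtain ⟨v, k, hw, hlt, hk, hvs, hvt⟩ := cs.exists_dihedral_factorization hs ht
  obtain ⟨R, h0, h1, hR, hpos, -⟩ := exists_dihedral_coefficients M hst
  have hs0 := ih _ hlt v s hvs rfl
  have ht0 := ih _ hlt v t hvt rfl
  have hRk := hpos k fun h => by have := hk h; omega
  have hRk1 := hpos (k + 1) hk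
  rw [hw, geomRep_mul_apply, cs.geomRep_wordProd_alternatingWord h0 h1 hR]
  split_ifs <;> rw [map_add, map_smul, map_smul] <;>
    exact add_nonneg (smul_nonneg (by assumption) hs0) (smul_nonneg (by assumption) ht0)

theorem geomRep_simple_simpleRoot (s : B) :
    cs.geomRep (cs.simple s) (simpleRoot s) = - simpleRoot s := by
  rw [geomRep_simple_apply, coxeterForm_simpleRoot_self]
  module

theorem geomRep_simpleRoot_nonpos (w : W) (s : B) (hs : cs.IsRightDescent w s) :
    cs.geomRep w (simpleRoot s) ≤ 0 := by
  have h := cs.geomRep_simpleRoot_nonneg (w * cs.simple s) s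
    (cs.isRightDescent_iff_not_isRightDescent_mul.mp hs)
  rw [geomRep_mul_apply, geomRep_simple_simpleRoot, map_neg] at h
  exact neg_nonneg.mp h

theorem eq_one_of_geomRep_eq_one {w : W} (hw : cs.geomRep w = 1) : w = 1 := by
  classical
  by_contra hne
  obtain ⟨s, hs⟩ := cs.exists_rightDescent_of_ne_one hne
  have h := cs.geomRep_simpleRoot_nonpos w s hs s
  rw [hw] at h
  norm_num [simpleRoot] at h

/-- A submodule invariant under the geometric representation and containing a simple root
is everything when the Coxeter graph is connected. -/
theorem submodule_eq_top_of_simpleRoot_mem (hconn : (coxeterGraph M).Connected)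
    {U : Submodule ℝ (B → ℝ)} (hU : ∀ i, ∀ v ∈ U, cs.geomRep (cs.simple i) v ∈ U) {i : B}
    (hi : simpleRoot i ∈ U) : U = ⊤ := by
  have hall : ∀ j, simpleRoot j ∈ U := by
    intro j
    obtain ⟨p⟩ := hconn.preconnected i j
    induction p with
    | nil => exact hi
    | cons hadj _ ih =>
      apply ih
      rename_i u v _ _
      have h := U.sub_mem hi (hU v _ hi)
      rw [geomRep_simple_apply, coxeterForm_simpleRoot, sub_sub_cancel] at h
      exact (U.smul_mem_iff (mul_ne_zero two_ne_zero (coxeterBilinMatrix_neg_of_adj hadj).ne)).mp h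
  rw [eq_top_iff]
  intro v _
  rw [← sum_smul_simpleRoot v]
  exact U.sum_mem fun j _ => U.smul_mem _ (hall j)

/-- Translates of an antidominant vector dominate it. -/
theorem le_geomRep {u : B → ℝ} (hu : ∀ i, coxeterForm M u (simpleRoot i) ≤ 0) (w : W) :
    u ≤ cs.geomRep w u := by
  induction hn : cs.length w generalizing w with
  | zero => rw [cs.length_eq_zero_iff.mp hn]; simp
  | succ n ih =>
    have hw1 : w ≠ 1 := by rintro rfl; simp at hn
    obtain ⟨s, hs⟩ := cs.exists_rightDescent_of_ne_one hw1
    have hlen := cs.isRightDescent_iff.mp hs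
    have hle := ih (w * cs.simple s) (by omega)
    have hpos := cs.geomRep_simpleRoot_nonpos w s hs
    rw [geomRep_mul_apply, geomRep_simple_apply, map_sub, map_smul] at hle
    intro i
    have h1 := hle i
    have h2 := hpos i
    have h3 := hu s
    simp only [Pi.sub_apply, Pi.smul_apply, smul_eq_mul, Pi.zero_apply] at h1 h2
    nlinarith

/-- A set of group elements with bounded orbits in the geometric representation is finite,
provided there is a strictly antidominant vector. -/
theorem finite_of_bounded_orbits {S : Set W} {u : B → ℝ}
    (hu : ∀ i, coxeterForm M u (simpleRoot i) < 0)
    (hS : ∀ v, ∃ C, ∀ h ∈ S, ‖cs.geomRep h v‖ ≤ C) : S.Finite := by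
  cases isEmpty_or_nonempty B with
  | inl hB =>
    have : ∀ w : W, w = 1 := fun w => cs.eq_one_of_geomRep_eq_one (by
      ext v i; exact isEmptyElim i)
    exact (Set.finite_singleton (1 : W)).subset fun w _ => this w
  | inr hB =>
  obtain ⟨K, hK, hKle⟩ := exists_norm_coxeterForm_le M
  choose C hC using fun i : B => hS (simpleRoot i)
  obtain ⟨C₀, hC₀⟩ := hS u
  have hCpos : 0 < ∑ i, |C i| + 1 := by positivity
  set D := ∑ i, |C i| + 1 with hD
  obtain ⟨i₀, -, hi₀⟩ := Finset.exists_max_image Finset.univ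
    (fun i => coxeterForm M u (simpleRoot i)) Finset.univ_nonempty
  set δ := - coxeterForm M u (simpleRoot i₀) with hδ
  have hδ0 : 0 < δ := neg_pos.mpr (hu i₀)
  refine Set.Finite.of_bounded_of_separated (f := fun h => cs.geomRep h u) (ε := δ / (K * D))
    ?_ (by positivity) ?_
  · rw [isBounded_iff_forall_norm_le]
    exact ⟨C₀, by rintro _ ⟨h, hh, rfl⟩; exact hC₀ h hh⟩
  intro h hh h' hh' hne
  have hw1 : h'⁻¹ * h ≠ 1 := fun e => hne (inv_mul_eq_one.mp e).symm
  obtain ⟨s, hs⟩ := cs.exists_leftDescent_of_ne_one hw1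
  rw [← cs.isRightDescent_inv_iff] at hs
  have hneg := cs.geomRep_simpleRoot_nonpos _ s hs
  have h1 : 0 ≤ coxeterForm M (cs.geomRep (h'⁻¹ * h) u) (simpleRoot s) := by
    rw [coxeterForm_geomRep_left, coxeterForm_eq_sum]
    exact Finset.sum_nonneg fun i _ => mul_nonneg_of_nonpos_of_nonpos (hneg i) (hu i).le
  have h2 : coxeterForm M u (simpleRoot s) ≤ -δ := by
    rw [hδ, neg_neg]; exact hi₀ s (Finset.mem_univ s)
  have h3 : δ ≤ coxeterForm M (cs.geomRep h u - cs.geomRep h' u)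
      (cs.geomRep h' (simpleRoot s)) := by
    have e : cs.geomRep h u = cs.geomRep h' (cs.geomRep (h'⁻¹ * h) u) := by
      rw [← geomRep_mul_apply]; simp
    rw [e, ← map_sub, coxeterForm_geomRep, map_sub, LinearMap.sub_apply]
    linarith
  have h4 := (le_abs_self _).trans (hKle (cs.geomRep h u - cs.geomRep h' u)
    (cs.geomRep h' (simpleRoot s)))
  have h5 : ‖cs.geomRep h' (simpleRoot s)‖ ≤ D := by
    have := Finset.single_le_sum (f := fun i => |C i|) (fun i _ => abs_nonneg _)
      (Finset.mem_univ s)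
    linarith [hC s h' hh', le_abs_self (C s)]
  rw [div_le_iff₀ (by positivity), dist_eq_norm]
  calc δ ≤ K * ‖cs.geomRep h u - cs.geomRep h' u‖ * ‖cs.geomRep h' (simpleRoot s)‖ := h3.trans h4
    _ ≤ K * ‖cs.geomRep h u - cs.geomRep h' u‖ * D := by gcongr
    _ = _ := by ring

theorem finite_of_posDef (cs : CoxeterSystem M W) (hM : (coxeterBilinMatrix M).PosDef) : Finite W := by
  classical
  cases isEmpty_or_nonempty B with
  | inl hB =>
    have : Subsingleton W := ⟨fun w w' => by
      rw [cs.eq_one_of_geomRep_eq_one (w := w) (by ext v i; exact isEmptyElim i),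
        cs.eq_one_of_geomRep_eq_one (w := w') (by ext v i; exact isEmptyElim i)]⟩
    infer_instance
  | inr hB =>
  set A := coxeterBilinMatrix M with hA
  obtain ⟨μ, x, hx0, hxμ, hmin⟩ := A.exists_min_quadratic
  have hμ : 0 < μ := by
    have h1 := ((Matrix.posDef_iff_dotProduct_mulVec).mp hM).2 hx0
    rw [star_trivial, hxμ] at h1
    exact pos_of_mul_pos_left h1 (dotProduct_self_star_nonneg x)
  have hu : ∀ i, coxeterForm M (A⁻¹.mulVec fun _ => -1) (simpleRoot i) < 0 := by
    intro i
    rw [coxeterForm_symm, coxeterForm_simpleRoot_left, ← hA, Matrix.mulVec_mulVec,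
      Matrix.mul_nonsing_inv _ ((Matrix.isUnit_iff_isUnit_det A).mp hM.isUnit), Matrix.one_mulVec]
    norm_num
  rw [← Set.finite_univ_iff]
  refine cs.finite_of_bounded_orbits hu fun v => ⟨√(coxeterForm M v v / μ), fun w _ => ?_⟩
  rw [pi_norm_le_iff_of_nonneg (Real.sqrt_nonneg _)]
  intro i
  rw [Real.norm_eq_abs]
  apply Real.abs_le_sqrt
  rw [le_div_iff₀ hμ, ← cs.coxeterForm_geomRep w, coxeterForm_apply]
  refine le_trans ?_ (hmin _)
  rw [mul_comm]
  gcongr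
  rw [sq]
  exact Finset.single_le_sum (f := fun i => cs.geomRep w v i * cs.geomRep w v i)
    (fun i _ => mul_self_nonneg _) (Finset.mem_univ i)

/-- The roots of the geometric representation. -/
def geomRoots : Set (B → ℝ) := {γ | ∃ w i, cs.geomRep w (simpleRoot i) = γ}

theorem simpleRoot_mem_geomRoots (i : B) : simpleRoot i ∈ cs.geomRoots := ⟨1, i, by simp⟩

theorem geomRep_mem_geomRoots {γ : B → ℝ} (hγ : γ ∈ cs.geomRoots) (w : W) :
    cs.geomRep w γ ∈ cs.geomRoots := by
  obtain ⟨w', i, rfl⟩ := hγ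
  exact ⟨w * w', i, by rw [geomRep_mul_apply]⟩

theorem coxeterForm_self_of_mem_geomRoots {γ : B → ℝ} (hγ : γ ∈ cs.geomRoots) :
    coxeterForm M γ γ = 1 := by
  obtain ⟨w, i, rfl⟩ := hγ
  rw [coxeterForm_geomRep, coxeterForm_simpleRoot_self]

theorem exists_geomRep_eq_reflection {γ : B → ℝ} (hγ : γ ∈ cs.geomRoots) :
    ∃ r : W, ∀ v, cs.geomRep r v = v - (2 * coxeterForm M v γ) • γ := by
  obtain ⟨w, i, rfl⟩ := hγ
  refine ⟨w * cs.simple i * w⁻¹, fun v => ?_⟩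
  rw [geomRep_mul_apply, geomRep_mul_apply, geomRep_simple_apply, map_sub, map_smul,
    geomRep_apply_inv_self, coxeterForm_geomRep_left, inv_inv]

theorem reflection_mem_geomRoots {γ δ : B → ℝ} (hγ : γ ∈ cs.geomRoots) (hδ : δ ∈ cs.geomRoots) :
    γ - (2 * coxeterForm M γ δ) • δ ∈ cs.geomRoots := by
  obtain ⟨r, hr⟩ := cs.exists_geomRep_eq_reflection hδ
  rw [← hr]
  exact cs.geomRep_mem_geomRoots hγ r

theorem submodule_eq_top_of_form_ne_zero (hconn : (coxeterGraph M).Connected)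
    {U : Submodule ℝ (B → ℝ)} (hU : ∀ i, ∀ v ∈ U, cs.geomRep (cs.simple i) v ∈ U) {v : B → ℝ}
    (hv : v ∈ U) {i : B} (hi : coxeterForm M v (simpleRoot i) ≠ 0) : U = ⊤ := by
  apply cs.submodule_eq_top_of_simpleRoot_mem hconn hU (i := i)
  have h := U.sub_mem hv (hU i v hv)
  rw [geomRep_simple_apply, sub_sub_cancel] at h
  exact (U.smul_mem_iff (mul_ne_zero two_ne_zero hi)).mp h

theorem span_roots_not_orthogonal_eq_top (hconn : (coxeterGraph M).Connected) (i : B) :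
    Submodule.span ℝ {γ | γ ∈ cs.geomRoots ∧ coxeterForm M (simpleRoot i) γ ≠ 0} = ⊤ := by
  set S := {γ | γ ∈ cs.geomRoots ∧ coxeterForm M (simpleRoot i) γ ≠ 0} with hS
  apply cs.submodule_eq_top_of_simpleRoot_mem hconn (i := i)
  · intro j v hv
    suffices h : Submodule.span ℝ S ≤
        (Submodule.span ℝ S).comap (cs.geomRep (cs.simple j)).toLinearMap from h hv
    rw [Submodule.span_le]
    rintro γ ⟨hγ, hγi⟩
    change cs.geomRep (cs.simple j) γ ∈ Submodule.span ℝ S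
    by_cases hj : coxeterForm M (simpleRoot i) (simpleRoot j) = 0
    · refine Submodule.subset_span ⟨cs.geomRep_mem_geomRoots hγ _, ?_⟩
      rwa [geomRep_simple_apply, map_sub, map_smul, hj, smul_zero, sub_zero]
    · rw [geomRep_simple_apply]
      exact Submodule.sub_mem _ (Submodule.subset_span ⟨hγ, hγi⟩)
        (Submodule.smul_mem _ _ (Submodule.subset_span ⟨cs.simpleRoot_mem_geomRoots j, hj⟩))
  · exact Submodule.subset_span ⟨cs.simpleRoot_mem_geomRoots i, by
      rw [coxeterForm_simpleRoot_self]; exact one_ne_zero⟩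

/-- If all the pairings `b(hγ, γ)` are at most one then all symmetrised matrix coefficients
are bounded. -/
theorem exists_bound_symmetrized (hconn : (coxeterGraph M).Connected) {H : Subgroup W}
    (hH : ∀ h ∈ H, ∀ γ ∈ cs.geomRoots, |coxeterForm M (cs.geomRep h γ) γ| ≤ 1) (i : B)
    (w : B → ℝ) : ∃ C, ∀ h ∈ H, |coxeterForm M (cs.geomRep h (simpleRoot i)) w
      + coxeterForm M (cs.geomRep h w) (simpleRoot i)| ≤ C := by
  have hw : w ∈ Submodule.span ℝ
      {γ | γ ∈ cs.geomRoots ∧ coxeterForm M (simpleRoot i) γ ≠ 0} := by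
    rw [cs.span_roots_not_orthogonal_eq_top hconn]; trivial
  induction hw using Submodule.span_induction with
  | mem γ hγ =>
    obtain ⟨hγ, hγi⟩ := hγ
    set β := coxeterForm M (simpleRoot i) γ with hβ
    refine ⟨(2 + 4 * β ^ 2) / (2 * |β|), fun h hh => ?_⟩
    have h1 := hH h hh _ (cs.simpleRoot_mem_geomRoots i)
    have h2 := hH h hh _ hγ
    have h3 := hH h hh _ (cs.reflection_mem_geomRoots (cs.simpleRoot_mem_geomRoots i) hγ)
    simp only [map_sub, map_smul, LinearMap.sub_apply, LinearMap.smul_apply, smul_eq_mul,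
      ← hβ] at h3
    set X := coxeterForm M (cs.geomRep h (simpleRoot i)) γ
    set Y := coxeterForm M (cs.geomRep h γ) (simpleRoot i)
    rw [le_div_iff₀ (by positivity)]
    have h4 : |X + Y| * (2 * |β|) = |2 * β * (X + Y)| := by
      rw [abs_mul, abs_mul, abs_two]; ring
    rw [h4]
    rw [abs_le] at h1 h2 h3 ⊢
    constructor <;> nlinarith [sq_nonneg β]
  | zero => exact ⟨0, fun h _ => by simp⟩
  | add x y _ _ hx hy =>
    obtain ⟨C, hC⟩ := hx
    obtain ⟨D, hD⟩ := hy
    refine ⟨C + D, fun h hh => le_trans (le_of_eq ?_) ((abs_add_le _ _).trans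
      (add_le_add (hC h hh) (hD h hh)))⟩
    simp only [map_add, LinearMap.add_apply]
    congr 1
    ring
  | smul a x _ hx =>
    obtain ⟨C, hC⟩ := hx
    refine ⟨|a| * C, fun h hh => le_trans (le_of_eq ?_)
      (mul_le_mul_of_nonneg_left (hC h hh) (abs_nonneg a))⟩
    simp only [map_smul, LinearMap.smul_apply, smul_eq_mul]
    rw [← abs_mul]
    congr 1
    ring

theorem exists_bound_form_self (hconn : (coxeterGraph M).Connected) {H : Subgroup W}
    (hH : ∀ h ∈ H, ∀ γ ∈ cs.geomRoots, |coxeterForm M (cs.geomRep h γ) γ| ≤ 1)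
    (u : B → ℝ) : ∃ C, ∀ h ∈ H, |coxeterForm M (cs.geomRep h u) u| ≤ C := by
  choose C hC using fun i => cs.exists_bound_symmetrized hconn hH i u
  refine ⟨∑ i, |u i| * C i, fun h hh => ?_⟩
  have hsum : 2 * coxeterForm M (cs.geomRep h u) u
      = ∑ i, u i * (coxeterForm M (cs.geomRep h (simpleRoot i)) u
        + coxeterForm M (cs.geomRep h u) (simpleRoot i)) := by
    simp only [mul_add, Finset.sum_add_distrib]
    rw [← coxeterForm_eq_sum]
    have : coxeterForm M (cs.geomRep h u) u
        = ∑ i, u i * coxeterForm M (cs.geomRep h (simpleRoot i)) u := by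
      conv_lhs => rw [coxeterForm_geomRep_left, coxeterForm_symm, coxeterForm_eq_sum]
      refine Finset.sum_congr rfl fun i _ => ?_
      rw [coxeterForm_symm, ← coxeterForm_geomRep_left]
    rw [← this]
    ring
  have hle : |2 * coxeterForm M (cs.geomRep h u) u| ≤ ∑ i, |u i| * C i := by
    rw [hsum]
    refine (Finset.abs_sum_le_sum_abs _ _).trans (Finset.sum_le_sum fun i _ => ?_)
    rw [abs_mul]
    exact mul_le_mul_of_nonneg_left (hC i h hh) (abs_nonneg _)
  rw [abs_mul, abs_two] at hle
  linarith [abs_nonneg (coxeterForm M (cs.geomRep h u) u)]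

/-- The vectors with bounded orbit under a normal subgroup form an invariant subspace. -/
theorem bounded_orbits_of_bounded_orbit (hconn : (coxeterGraph M).Connected) {H : Subgroup W}
    [H.Normal] {u : B → ℝ} {i : B} (hi : coxeterForm M u (simpleRoot i) ≠ 0)
    (hu : ∃ C, ∀ h ∈ H, ‖cs.geomRep h u‖ ≤ C) (v : B → ℝ) :
    ∃ C, ∀ h ∈ H, ‖cs.geomRep h v‖ ≤ C := by
  let U : Submodule ℝ (B → ℝ) :=
    { carrier := {v | ∃ C, ∀ h ∈ H, ‖cs.geomRep h v‖ ≤ C}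
      zero_mem' := ⟨0, fun h _ => by simp⟩
      add_mem' := by
        rintro x y ⟨C, hC⟩ ⟨D, hD⟩
        refine ⟨C + D, fun h hh => ?_⟩
        rw [map_add]
        exact (norm_add_le _ _).trans (add_le_add (hC h hh) (hD h hh))
      smul_mem' := by
        rintro a x ⟨C, hC⟩
        refine ⟨‖a‖ * C, fun h hh => ?_⟩
        rw [map_smul, norm_smul]
        exact mul_le_mul_of_nonneg_left (hC h hh) (norm_nonneg a) }
  have hU : U = ⊤ := by
    refine cs.submodule_eq_top_of_form_ne_zero hconn (fun j x hx => ?_) (v := u) hu hi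
    obtain ⟨C, hC⟩ := hx
    let f := LinearMap.toContinuousLinearMap (cs.geomRep (cs.simple j)).toLinearMap
    refine ⟨‖f‖ * C, fun h hh => ?_⟩
    have hconj := hC _ (Subgroup.Normal.conj_mem ‹_› h hh (cs.simple j)⁻¹)
    have e : cs.geomRep h (cs.geomRep (cs.simple j) x)
        = f (cs.geomRep ((cs.simple j)⁻¹ * h * (cs.simple j)⁻¹⁻¹) x) := by
      change _ = cs.geomRep (cs.simple j) _
      rw [← geomRep_mul_apply, ← geomRep_mul_apply]
      congr 2
      group
    rw [e]
    exact (f.le_opNorm _).trans (mul_le_mul_of_nonneg_left hconj (norm_nonneg f))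
  exact (hU ▸ Submodule.mem_top : v ∈ U)

theorem form_geomRep_self_neg {u : B → ℝ} (hpos : ∀ i, 0 < u i)
    (hu : ∀ i, coxeterForm M u (simpleRoot i) < 0) [Nonempty B] (w : W) :
    coxeterForm M (cs.geomRep w u) u < 0 := by
  rw [coxeterForm_symm, coxeterForm_eq_sum]
  exact Finset.sum_neg (fun i _ => mul_neg_of_pos_of_neg
    ((hpos i).trans_le (cs.le_geomRep (fun i => (hu i).le) w i)) (hu i)) Finset.univ_nonempty

/-- A finite normal subgroup acts trivially as soon as the form is indefinite. -/
theorem eq_bot_of_finite (cs : CoxeterSystem M W) (hconn : (coxeterGraph M).Connected)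
    {u : B → ℝ} (hpos : ∀ i, 0 < u i) (hu : ∀ i, coxeterForm M u (simpleRoot i) < 0) {H : Subgroup W} [H.Normal] [Finite H] :
    H = ⊥ := by
  classical
  have := hconn.nonempty
  have := Fintype.ofFinite H
  set z := ∑ h : H, cs.geomRep (h : W) u with hz
  have hzfix : ∀ h ∈ H, cs.geomRep h z = z := by
    intro h hh
    rw [hz, map_sum]
    refine Fintype.sum_equiv (Equiv.mulLeft (⟨h, hh⟩ : H)) _ _ fun x => ?_
    simp [LinearEquiv.mul_apply]
  have hzu : coxeterForm M z u < 0 := by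
    rw [hz, map_sum, LinearMap.sum_apply]
    exact Finset.sum_neg (fun h _ => cs.form_geomRep_self_neg hpos hu _) Finset.univ_nonempty
  obtain ⟨i, hi⟩ : ∃ i, coxeterForm M z (simpleRoot i) ≠ 0 := by
    by_contra! h
    rw [coxeterForm_eq_sum] at hzu
    simp [h] at hzu
  let U : Submodule ℝ (B → ℝ) :=
    { carrier := {v | ∀ h ∈ H, cs.geomRep h v = v}
      zero_mem' := fun h _ => map_zero _
      add_mem' := fun hx hy h hh => by rw [map_add, hx h hh, hy h hh]
      smul_mem' := fun a x hx h hh => by rw [map_smul, hx h hh] }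
  have hU : U = ⊤ := by
    refine cs.submodule_eq_top_of_form_ne_zero hconn (fun j x hx h hh => ?_) (v := z) hzfix hi
    have hconj := hx _ (Subgroup.Normal.conj_mem ‹_› h hh (cs.simple j)⁻¹)
    conv_rhs => rw [← hconj]
    rw [← geomRep_mul_apply, ← geomRep_mul_apply]
    congr 2
    group
  rw [Subgroup.eq_bot_iff_forall]
  intro h hh
  apply cs.eq_one_of_geomRep_eq_one
  ext1 v
  exact (hU ▸ Submodule.mem_top : v ∈ U) h hh

/-- A nontrivial normal subgroup of an indefinite irreducible Coxeter group moves some root to a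
root spanning with it an indefinite plane. -/
theorem exists_one_lt_abs_form (hconn : (coxeterGraph M).Connected)
    (hM : ¬ (coxeterBilinMatrix M).PosSemidef) {H : Subgroup W} [H.Normal] (hH : H ≠ ⊥) :
    ∃ h ∈ H, ∃ γ ∈ cs.geomRoots, 1 < |coxeterForm M (cs.geomRep h γ) γ| := by
  by_contra! hle
  have := hconn.nonempty
  obtain ⟨u, hpos, hu⟩ := exists_pos_antidominant hconn hM
  obtain ⟨C, hC⟩ := cs.exists_bound_form_self hconn hle u
  have hbdd : ∃ D, ∀ h ∈ H, ‖cs.geomRep h u‖ ≤ D := by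
    let E : B → ℝ := fun i => u i + 2 * C / (- coxeterForm M u (simpleRoot i))
    have hcoord : ∀ h ∈ H, ∀ i, |cs.geomRep h u i| ≤ E i := by
      intro h hh i
      have hle' := cs.le_geomRep (fun i => (hu i).le) h
      rw [abs_of_nonneg ((hpos i).le.trans (hle' i))]
      have h1 : (cs.geomRep h u i - u i) * (- coxeterForm M u (simpleRoot i))
          ≤ ∑ j, (cs.geomRep h u j - u j) * (- coxeterForm M u (simpleRoot j)) :=
        Finset.single_le_sum
          (f := fun j => (cs.geomRep h u j - u j) * (- coxeterForm M u (simpleRoot j)))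
          (fun j _ => mul_nonneg (sub_nonneg.mpr (hle' j)) (neg_nonneg.mpr (hu j).le))
          (Finset.mem_univ i)
      have h2 : ∑ j, (cs.geomRep h u j - u j) * (- coxeterForm M u (simpleRoot j))
          = coxeterForm M u u - coxeterForm M (cs.geomRep h u) u := by
        rw [coxeterForm_symm M (cs.geomRep h u), coxeterForm_eq_sum M u u,
          coxeterForm_eq_sum M u (cs.geomRep h u), ← Finset.sum_sub_distrib]
        exact Finset.sum_congr rfl fun j _ => by ring
      have h3 := abs_le.mp (hC h hh)
      have h4 := abs_le.mp (hC 1 H.one_mem)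
      simp only [map_one, LinearEquiv.coe_one, id] at h4
      have h5 : cs.geomRep h u i - u i ≤ 2 * C / (- coxeterForm M u (simpleRoot i)) := by
        rw [le_div_iff₀ (neg_pos.mpr (hu i))]
        linarith
      simp only [E]
      linarith
    have hE : ∀ i, 0 ≤ E i := fun i => (abs_nonneg _).trans (hcoord 1 H.one_mem i)
    refine ⟨∑ i, E i, fun h hh => ?_⟩
    rw [pi_norm_le_iff_of_nonneg (Finset.sum_nonneg fun i _ => hE i)]
    intro i
    exact (hcoord h hh i).trans (Finset.single_le_sum (fun j _ => hE j) (Finset.mem_univ i))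
  have hfin : (H : Set W).Finite := cs.finite_of_bounded_orbits hu fun v =>
    cs.bounded_orbits_of_bounded_orbit hconn (hu (Classical.arbitrary B)).ne hbdd v
  have : Finite H := hfin
  exact hH (cs.eq_bot_of_finite hconn hpos hu)

/-- For a boost in an indefinite irreducible Coxeter group some root is neither orthogonal to the
plane of the boost nor has its projection to that plane of norm one. -/
theorem exists_root_of_isBoost (hconn : (coxeterGraph M).Connected)
    (hM : ¬ (coxeterBilinMatrix M).PosSemidef) {g : W} {x y : B → ℝ} {lam : ℝ}
    (hg : IsBoost (coxeterForm M) (cs.geomRep g) x y lam) :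
    ∃ γ ∈ cs.geomRoots, ¬ (coxeterForm M x γ = 0 ∧ coxeterForm M y γ = 0) ∧
      2 * (coxeterForm M x γ * coxeterForm M y γ) ≠ coxeterForm M x y := by
  by_contra! htype
  replace htype : ∀ γ ∈ cs.geomRoots, (coxeterForm M x γ = 0 ∧ coxeterForm M y γ = 0) ∨
      2 * (coxeterForm M x γ * coxeterForm M y γ) = coxeterForm M x y := fun γ hγ =>
    or_iff_not_imp_left.mpr fun h => htype γ hγ fun h1 h2 => h ⟨h1, h2⟩
  have hc := hg.pair_ne_zero
  have hpair := fun {γ δ : B → ℝ} (hγ : γ ∈ cs.geomRoots) (hδ : δ ∈ cs.geomRoots) =>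
    hg.pairing_eq (coxeterForm_symm M) (fun γ hγ δ hδ => cs.reflection_mem_geomRoots hγ hδ)
      (fun γ hγ => cs.geomRep_mem_geomRoots hγ g) htype hγ hδ
  set p : B → ℝ := fun i => coxeterForm M x (simpleRoot i) with hp
  set q : B → ℝ := fun i => coxeterForm M y (simpleRoot i) with hq
  set c := coxeterForm M x y with hcdef
  obtain ⟨i₀, hi₀⟩ : ∃ i, p i ≠ 0 := by
    by_contra! h
    apply hc
    rw [hcdef, coxeterForm_eq_sum]
    exact Finset.sum_eq_zero fun i _ => by rw [show coxeterForm M x (simpleRoot i) = 0 from h i,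
      mul_zero]
  have hprop : ∀ i j, (coxeterGraph M).Adj i j → 2 * (p i * q i) = c → 2 * (p j * q j) = c := by
    intro i j hij hi
    refine (htype _ (cs.simpleRoot_mem_geomRoots j)).resolve_left fun ⟨hpj, hqj⟩ => ?_
    have hmem := cs.reflection_mem_geomRoots (cs.simpleRoot_mem_geomRoots i)
      (cs.simpleRoot_mem_geomRoots j)
    set γ := simpleRoot i - (2 * coxeterForm M (simpleRoot i) (simpleRoot j)) • simpleRoot j with hγ
    have hpγ : coxeterForm M x γ = p i := by
      rw [hγ, map_sub, map_smul, hpj, smul_zero, sub_zero]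
    have hqγ : coxeterForm M y γ = q i := by
      rw [hγ, map_sub, map_smul, hqj, smul_zero, sub_zero]
    have h := hpair hmem (cs.simpleRoot_mem_geomRoots i) (by rw [hpγ, hqγ]; exact hi) hi
    rw [hpγ, hqγ, eq_div_iff hc] at h
    simp only [hγ, map_sub, map_smul, LinearMap.sub_apply, LinearMap.smul_apply, smul_eq_mul,
      coxeterForm_simpleRoot_self, coxeterForm_simpleRoot, coxeterBilinMatrix_symm M j i] at h
    have h0 : coxeterBilinMatrix M i j * coxeterBilinMatrix M i j * c = 0 := by
      linear_combination (-1 / 2) * h - (1 / 2) * hi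
    simp [hc, (coxeterBilinMatrix_neg_of_adj hij).ne] at h0
  have hall : ∀ j, 2 * (p j * q j) = c := by
    intro j
    have h₀ : 2 * (p i₀ * q i₀) = c :=
      (htype _ (cs.simpleRoot_mem_geomRoots i₀)).resolve_left fun h => hi₀ h.1
    obtain ⟨path⟩ := hconn.preconnected i₀ j
    clear hi₀
    induction path with
    | nil => exact h₀
    | cons hadj _ ih => exact ih (hprop _ _ hadj h₀)
  have hb : ∀ i j, coxeterBilinMatrix M i j * c = p i * q j + q i * p j := by
    intro i j
    have h := hpair (cs.simpleRoot_mem_geomRoots i) (cs.simpleRoot_mem_geomRoots j)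
      (hall i) (hall j)
    rwa [eq_div_iff hc, coxeterForm_simpleRoot] at h
  have hprop' : ∀ i j, p i * q j = q i * p j := by
    intro i j
    have hsq : coxeterBilinMatrix M i j ^ 2 ≤ 1 := by
      by_cases hij : i = j
      · subst hij
        rw [← coxeterForm_simpleRoot, coxeterForm_simpleRoot_self, one_pow]
      · nlinarith [coxeterBilinMatrix_nonpos M hij, neg_one_le_coxeterBilinMatrix M i j]
    have h1 : (coxeterBilinMatrix M i j * c) ^ 2 ≤ c * c := by nlinarith [sq_nonneg c]
    rw [hb] at h1
    nth_rewrite 1 [← hall i] at h1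
    rw [← hall j] at h1
    have h2 : (p i * q j - q i * p j) ^ 2 ≤ 0 := by nlinarith
    exact sub_eq_zero.mp (pow_eq_zero_iff two_ne_zero |>.mp (le_antisymm h2 (sq_nonneg _)))
  have hq₀ : q i₀ ≠ 0 := by
    intro h
    apply hc
    rw [← hall i₀, h, mul_zero, mul_zero]
  apply hM
  have hA : coxeterBilinMatrix M
      = Matrix.vecMulVec (fun i => q i / q i₀) (star fun i => q i / q i₀) := by
    ext i j
    have h1 := hb i j
    have h2 := hall i₀
    have h3 := hprop' i₀ i
    have h4 := hprop' i₀ j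
    rw [← h2] at h1
    simp only [Matrix.vecMulVec_apply, star_trivial]
    field_simp
    apply mul_left_cancel₀ (mul_ne_zero two_ne_zero hi₀)
    linear_combination q i₀ * h1 - q j * h3 - q i * h4
  rw [hA]
  exact Matrix.posSemidef_vecMulVec_self_star _

theorem exists_transverse_conjugate (hconn : (coxeterGraph M).Connected)
    (hM : ¬ (coxeterBilinMatrix M).PosSemidef) {g s : W} {x y : B → ℝ} {lam t : ℝ}
    (hg : IsBoost (coxeterForm M) (cs.geomRep g) x y lam) (ht : t ≠ 0)
    (hsy : cs.geomRep s y = t • x) :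
    ∃ w : W, ∀ z ∈ ({x, y} : Set (B → ℝ)), ∀ z' ∈ ({x, y} : Set (B → ℝ)),
      coxeterForm M z (cs.geomRep w z') ≠ 0 := by
  have hc := hg.pair_ne_zero
  have hxx := hg.left_isotropic
  have hyy := hg.right_isotropic
  have hyx : coxeterForm M y x = coxeterForm M x y := coxeterForm_symm M y x
  obtain ⟨k, hkx, hky⟩ : ∃ k : W, coxeterForm M x (cs.geomRep k x) ≠ 0 ∧
      coxeterForm M y (cs.geomRep k x) ≠ 0 := by
    obtain ⟨γ, hγ, h0, h3⟩ := cs.exists_root_of_isBoost hconn hM hg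
    obtain ⟨r, hr⟩ := cs.exists_geomRep_eq_reflection hγ
    by_cases hp : coxeterForm M x γ = 0
    · have hq : coxeterForm M y γ ≠ 0 := fun h => h0 ⟨hp, h⟩
      have hsx : x = t⁻¹ • cs.geomRep s y := by rw [hsy, smul_smul, inv_mul_cancel₀ ht, one_smul]
      have hk : cs.geomRep (r * s⁻¹) x = t⁻¹ • cs.geomRep r y := by
        rw [geomRep_mul_apply]
        nth_rewrite 1 [hsx]
        rw [map_smul, map_smul, geomRep_inv_apply_self]
      refine ⟨r * s⁻¹, ?_, ?_⟩ <;> rw [hk] <;> simp [hr, hp, hq, ht, hc, hyy]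
    · refine ⟨r, ?_, ?_⟩
      · simp [hr, hxx, hp]
      · rw [hr, map_sub, map_smul, hyx, smul_eq_mul, sub_ne_zero]
        intro h
        exact h3 (by linear_combination -h)
  obtain ⟨n, hn⟩ := hg.exists_transverse (coxeterForm_symm M) (cs.coxeterForm_geomRep s)
    (cs.coxeterForm_geomRep k) ht hsy hkx hky
  exact ⟨k * g ^ n * s⁻¹ * k⁻¹, by simpa only [map_mul, map_pow, map_inv] using hn⟩

theorem not_isNarrow_of_ne_bot (cs : CoxeterSystem M W)
    (hconn : (coxeterGraph M).Connected) (hM : ¬ (coxeterBilinMatrix M).PosSemidef)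
    {H : Subgroup W} [hN : H.Normal] (hH : H ≠ ⊥) :
    ¬ IsNarrow H := by
  obtain ⟨h, hh, α, hα, hlt⟩ := cs.exists_one_lt_abs_form hconn hM hH
  obtain ⟨s, hs⟩ := cs.exists_geomRep_eq_reflection hα
  have hhs : ∀ v, cs.geomRep (h * s * h⁻¹) v
      = v - (2 * coxeterForm M v (cs.geomRep h α)) • cs.geomRep h α := by
    intro v
    rw [geomRep_mul_apply, geomRep_mul_apply, hs, map_sub, map_smul, geomRep_apply_inv_self,
      coxeterForm_geomRep_left, inv_inv]
  obtain ⟨x, y, lam, t, hg, ht, hsy⟩ := exists_isBoost_mul (coxeterForm_symm M)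
    (cs.coxeterForm_self_of_mem_geomRoots hα)
    (cs.coxeterForm_self_of_mem_geomRoots (cs.geomRep_mem_geomRoots hα h))
    (by rwa [coxeterForm_symm]) hs hhs
  rw [← map_mul] at hg
  have hss : s * s = 1 := by
    apply cs.eq_one_of_geomRep_eq_one
    ext1 v
    have h1 := cs.coxeterForm_self_of_mem_geomRoots hα
    simp only [geomRep_mul_apply, hs, map_sub, map_smul, LinearMap.sub_apply,
      LinearMap.smul_apply, smul_eq_mul, h1, LinearEquiv.coe_one, id]
    module
  have hgH : h * s * h⁻¹ * s ∈ H := by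
    have hs' : s = s⁻¹ := (inv_eq_of_mul_eq_one_left hss).symm
    have h2 := H.mul_mem hh (hN.conj_mem _ (H.inv_mem hh) s)
    rw [← hs'] at h2
    simpa only [mul_assoc] using h2
  set g := h * s * h⁻¹ * s
  obtain ⟨w, hw⟩ := cs.exists_transverse_conjugate hconn hM hg ht hsy
  have hg' := hg.conj (cs.geomRep w) (cs.coxeterForm_geomRep w)
  obtain ⟨N, hinj⟩ := hg.exists_injective_lift (coxeterForm_symm M) hg'
    (hw x (by simp) x (by simp)) (hw x (by simp) y (by simp)) (hw y (by simp) x (by simp))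
    (hw y (by simp) y (by simp))
  let f : FreeGroup (Fin 2) →* H := FreeGroup.lift
    ![(⟨g, hgH⟩ : H) ^ N, (⟨w * g * w⁻¹, hN.conj_mem g hgH w⟩ : H) ^ N]
  have hcomp : (cs.geomRep.comp H.subtype).comp f = FreeGroup.lift
      ![cs.geomRep g ^ N, (cs.geomRep w * cs.geomRep g * (cs.geomRep w)⁻¹) ^ N] := by
    ext1 i
    fin_cases i <;> simp [f]
  intro hnarrow
  apply hnarrow f
  rw [← hcomp, MonoidHom.coe_comp] at hinj
  exact hinj.of_comp

end CoxeterSystem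

/-- An irreducible Coxeter group that is neither finite (spherical) nor affine (i.e. is
generic) has no non-trivial narrow normal subgroup. -/
theorem stmt_9 {B : Type*} [Fintype B] {W : Type*} [Group W] {M : CoxeterMatrix B}
    (cs : CoxeterSystem M W) (hconn : (coxeterGraph M).Connected)
    (hnotfin : ¬ Finite W) (hnotaff : ¬ M.IsAffineType)
    (H : Subgroup W) [H.Normal] (hnarrow : IsNarrow H) :
    H = ⊥ := by
  by_contra hH
  have hM : ¬ (coxeterBilinMatrix M).PosSemidef := fun h =>
    hnotaff ⟨h, fun h' => hnotfin (cs.finite_of_posDef h')⟩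
  exact cs.not_isNarrow_of_ne_bot hconn hM hH hnarrow
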